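/- arXiv:1108.1852 — 5 statements merged into one kernel-verified Lean document; each statement's English description precedes it below -/
import Mathlib

section
/- Let F be a finite field with q elements, let S ⊆ F be a subset with |S| > 2, and set T = ∏_{γ∈S}(X−γ) ∈ F[X]. For a non-constant polynomial f ∈ F[X] the following are equivalent: (A) f is a minimal value set polynomial with V_f = S; (B) there exists a nonzero θ ∈ F such that T∘f = θ·(X^q − X)·f′. Moreover, for any nonzero θ ∈ F witnessing (B) there exists γ ∈ S with θ = −T′(γ). -/
open Polynomial

theorem Polynomial.prod_X_sub_C_dvd_of_isRoot {F : Type*} [Field F] {s : Finset F} {p : F[X]}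
    (h : ∀ a ∈ s, p.IsRoot a) : ∏ a ∈ s, (X - C a) ∣ p :=
  Finset.prod_dvd_of_coprime
    (fun _ _ _ _ hab => pairwise_coprime_X_sub_C Function.injective_id hab)
    fun a ha => dvd_iff_isRoot.2 (h a ha)

theorem Polynomial.isCoprime_sub_C_sub_C {F : Type*} [Field F] (f : F[X]) {a b : F}
    (hab : a ≠ b) : IsCoprime (f - C a) (f - C b) := by
  have h := (pairwise_coprime_X_sub_C (Function.injective_id (α := F)) hab).map
    (compRingHom f)
  simpa using h

theorem Polynomial.degree_lt_of_mul_degree_lt {F : Type*} [Field F] {L g B f : F[X]}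
    (hf : f = L * g) (hB : (L * B).degree < f.degree) : B.degree < g.degree := by
  rw [hf, degree_mul, degree_mul] at hB
  exact lt_of_add_lt_add_left hB

/-- Three members of the pencil spanned by `f` and `1` having large common factors with three
members of the pencil spanned by `h` and `N`, the latter of smaller degree, force one of the
latter to vanish. -/
theorem Polynomial.eq_zero_of_pencil_factors {F : Type*} [Field F] {f h N : F[X]}
    {γ₀ γ₁ γ₂ c₀ c₁ c₂ : F} {L₀ L₁ L₂ g₀ g₁ g₂ B₀ B₁ B₂ : F[X]}
    (hγ₀₁ : γ₀ ≠ γ₁) (hγ₀₂ : γ₀ ≠ γ₂) (hc : c₁ ≠ c₂)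
    (hg₀ : f - C γ₀ = L₀ * g₀) (hg₁ : f - C γ₁ = L₁ * g₁) (hg₂ : f - C γ₂ = L₂ * g₂)
    (hB₀ : C c₀ * h + N = L₀ * B₀) (hB₁ : C c₁ * h + N = L₁ * B₁)
    (hB₂ : C c₂ * h + N = L₂ * B₂)
    (hd₀ : B₀.degree < g₀.degree) (hd₁ : B₁.degree < g₁.degree) (hd₂ : B₂.degree < g₂.degree)
    (hd : (g₀ * g₁ * g₂).degree < f.degree) : C c₀ * h + N = 0 := by
  have hne₀ : g₀ ≠ 0 := by rintro rfl; simp at hd₀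
  have hne₁ : g₁ ≠ 0 := by rintro rfl; simp at hd₁
  have hne₂ : g₂ ≠ 0 := by rintro rfl; simp at hd₂
  have key : f * (C (c₁ - c₂) * (B₀ * (g₁ * g₂)) + C (c₂ - c₀) * (B₁ * (g₀ * g₂)) +
      C (c₀ - c₁) * (B₂ * (g₀ * g₁))) =
      C ((c₁ - c₂) * γ₀) * (B₀ * (g₁ * g₂)) + C ((c₂ - c₀) * γ₁) * (B₁ * (g₀ * g₂)) +
      C ((c₀ - c₁) * γ₂) * (B₂ * (g₀ * g₁)) := by
    simp only [C_sub, C_mul]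
    linear_combination (C c₁ - C c₂) * B₀ * g₁ * g₂ * hg₀ + (C c₂ - C c₀) * B₁ * g₀ * g₂ * hg₁ +
      (C c₀ - C c₁) * B₂ * g₀ * g₁ * hg₂ - (C c₁ - C c₂) * g₀ * g₁ * g₂ * hB₀
      - (C c₂ - C c₀) * g₀ * g₁ * g₂ * hB₁ - (C c₀ - C c₁) * g₀ * g₁ * g₂ * hB₂
  have bound : ∀ (c : F) {B g k : F[X]}, B.degree < g.degree → k ≠ 0 →
      (g * k).degree < f.degree → (C c * (B * k)).degree < f.degree := by
    intro c B g k hBg hk hgk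
    refine lt_of_le_of_lt ?_ hgk
    rw [← smul_eq_C_mul]
    refine (degree_smul_le _ _).trans ?_
    rw [degree_mul, degree_mul]
    gcongr
  have hQ : (C ((c₁ - c₂) * γ₀) * (B₀ * (g₁ * g₂)) + C ((c₂ - c₀) * γ₁) * (B₁ * (g₀ * g₂)) +
      C ((c₀ - c₁) * γ₂) * (B₂ * (g₀ * g₁))) = 0 := by
    refine eq_zero_of_dvd_of_degree_lt (Dvd.intro _ key) ?_
    refine (degree_add_le _ _).trans_lt
      (max_lt ((degree_add_le _ _).trans_lt (max_lt ?_ ?_)) ?_)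
    · exact bound _ hd₀ (mul_ne_zero hne₁ hne₂) (by rwa [← mul_assoc])
    · exact bound _ hd₁ (mul_ne_zero hne₀ hne₂) (by rwa [mul_left_comm, ← mul_assoc])
    · exact bound _ hd₂ (mul_ne_zero hne₀ hne₁) (by rwa [mul_comm])
  have hf : f ≠ 0 := by rintro rfl; simp at hd
  have hP := (mul_eq_zero.1 (key.trans hQ)).resolve_left hf
  have hrel : C ((c₁ - c₂) * (γ₀ - γ₂)) * (B₀ * g₁) = g₀ * (C ((c₂ - c₀) * (γ₂ - γ₁)) * B₁) := by
    apply mul_right_cancel₀ hne₂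
    simp only [C_sub, C_mul] at hP hQ ⊢
    linear_combination hQ - C γ₂ * hP
  have hcop : IsCoprime g₀ g₁ := by
    have := isCoprime_sub_C_sub_C f hγ₀₁
    rw [hg₀, hg₁] at this
    exact this.of_mul_left_right.of_mul_right_right
  have hu : IsUnit (C ((c₁ - c₂) * (γ₀ - γ₂))) :=
    isUnit_C.2 (mul_ne_zero (sub_ne_zero.2 hc) (sub_ne_zero.2 hγ₀₂)).isUnit
  have hdvd : g₀ ∣ B₀ := hcop.dvd_of_dvd_mul_right (hu.dvd_mul_left.1 (Dvd.intro _ hrel.symm))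
  rw [hB₀, eq_zero_of_dvd_of_degree_lt hdvd hd₀, mul_zero]

theorem Polynomial.degree_sub_C_of_natDegree_pos {F : Type*} [Field F] {f : F[X]}
    (hf : 0 < f.natDegree) (γ : F) : (f - C γ).degree = f.degree :=
  degree_sub_C (natDegree_pos_iff_degree_pos.1 hf)

theorem Polynomial.card_fiber_le_natDegree {F : Type*} [Field F] [Fintype F] [DecidableEq F]
    {f : F[X]} (hf : 0 < f.natDegree) (γ : F) :
    (Finset.univ.filter fun a => f.eval a = γ).card ≤ f.natDegree := by
  have hdvd : ∏ a ∈ Finset.univ.filter fun a => f.eval a = γ, (X - C a) ∣ f - C γ :=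
    prod_X_sub_C_dvd_of_isRoot fun a ha => by simpa [sub_eq_zero] using ha
  have h0 : f - C γ ≠ 0 := fun h => by
    rw [sub_eq_zero.1 h, natDegree_C] at hf
    exact hf.false
  simpa using natDegree_le_of_dvd hdvd h0

theorem Polynomial.card_le_natDegree_mul_card_image {F : Type*} [Field F] [Fintype F]
    [DecidableEq F] {f : F[X]} (hf : 0 < f.natDegree) :
    Fintype.card F ≤ f.natDegree * (Finset.univ.image fun a => f.eval a).card :=
  Finset.card_le_mul_card_image _ _ fun b _ => card_fiber_le_natDegree hf b

theorem Polynomial.eval_derivative_of_comp_eq {F : Type*} [Field F] [Fintype F] {T f N : F[X]}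
    (h : T.comp f = (X ^ Fintype.card F - X) * N) (a : F) :
    T.derivative.eval (f.eval a) * f.derivative.eval a + N.eval a = 0 := by
  have h' := congrArg (fun p => (derivative p).eval a) h
  simp only [derivative_comp, derivative_mul, derivative_sub, derivative_X_pow, derivative_X,
    eval_add, eval_mul, eval_sub, eval_pow, eval_X, eval_comp, FiniteField.cast_card_eq_zero,
    FiniteField.pow_card, C_0, eval_zero, eval_one] at h'
  linear_combination h'

/-- If a nonconstant polynomial attains exactly the values in `S` and its degree is as large as the
size of `S` allows, then it satisfies a first-order differential equation determined by `S`. -/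
theorem Polynomial.exists_comp_eq_of_image_eq {F : Type*} [Field F] [Fintype F] [DecidableEq F]
    {S : Finset F} (hS : 2 < S.card) {f : F[X]} (hf : 0 < f.natDegree)
    (himage : (Finset.univ.image fun a => f.eval a) = S)
    (hcard : f.natDegree * S.card < Fintype.card F + f.natDegree) :
    ∃ γ ∈ S, (∏ γ ∈ S, (X - C γ)).comp f =
      C (-(∏ γ ∈ S, (X - C γ)).derivative.eval γ) *
        ((X ^ Fintype.card F - X) * f.derivative) := by
  set T : F[X] := ∏ γ ∈ S, (X - C γ) with hT
  have hf0 : f ≠ 0 := by rintro rfl; simp at hf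
  have hne : ∀ γ, f - C γ ≠ 0 := fun γ => by
    rw [← degree_ne_bot, degree_sub_C_of_natDegree_pos hf]
    exact degree_ne_bot.2 hf0
  have hTdeg : (T.comp f).natDegree = S.card * f.natDegree := by
    rw [natDegree_comp, hT, natDegree_finsetProd_X_sub_C_eq_card]
  have hTf : T.comp f ≠ 0 := fun h => by
    rw [h, natDegree_zero] at hTdeg
    exact (Nat.mul_pos (by omega) hf).ne hTdeg
  have hqdeg := FiniteField.X_pow_card_sub_X_natDegree_eq F (Fintype.one_lt_card (α := F))
  have hq0 := FiniteField.X_pow_card_sub_X_ne_zero F (Fintype.one_lt_card (α := F))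
  obtain ⟨N, hN⟩ : (X ^ Fintype.card F - X : F[X]) ∣ T.comp f := by
    have hprod := prod_multiset_X_sub_C_of_monic_of_roots_card_eq
      (monic_X_pow_sub (p := (X : F[X])) (n := Fintype.card F)
        (by rw [degree_X]; exact_mod_cast Fintype.one_lt_card))
      (by rw [FiniteField.roots_X_pow_card_sub_X, hqdeg]; rfl)
    rw [FiniteField.roots_X_pow_card_sub_X] at hprod
    rw [← hprod]
    refine prod_X_sub_C_dvd_of_isRoot fun a _ => ?_
    have ha : f.eval a ∈ S := himage ▸ Finset.mem_image_of_mem _ (Finset.mem_univ a)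
    rw [IsRoot, eval_comp, hT, eval_prod]
    exact Finset.prod_eq_zero ha (by simp)
  have hN0 : N ≠ 0 := by rintro rfl; exact hTf (by rw [hN, mul_zero])
  have hNdeg : N.degree < f.degree := by
    rw [hN, natDegree_mul hq0 hN0, hqdeg, mul_comm] at hTdeg
    exact degree_lt_degree (by omega)
  have hAdeg : ∀ c : F, (C c * f.derivative + N).degree < f.degree := by
    intro c
    refine (degree_add_le _ _).trans_lt (max_lt ?_ hNdeg)
    rw [← smul_eq_C_mul]
    exact (degree_smul_le _ _).trans_lt (degree_derivative_lt hf0)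
  suffices h : ∃ γ ∈ S, C (T.derivative.eval γ) * f.derivative + N = 0 by
    obtain ⟨γ, hγ, h⟩ := h
    refine ⟨γ, hγ, ?_⟩
    rw [hN, C_neg]
    linear_combination (X ^ Fintype.card F - X) * h
  let l : F → ℕ := fun γ => (Finset.univ.filter fun a => f.eval a = γ).card
  have hfactor : ∀ γ, ∃ L g B : F[X], f - C γ = L * g ∧
      C (T.derivative.eval γ) * f.derivative + N = L * B ∧ B.degree < g.degree ∧
      L.natDegree = l γ ∧ g.natDegree = f.natDegree - l γ := by
    intro γ
    obtain ⟨g, hg⟩ : ∏ a ∈ Finset.univ.filter fun a => f.eval a = γ, (X - C a) ∣ f - C γ :=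
      prod_X_sub_C_dvd_of_isRoot fun a ha => by simpa [sub_eq_zero] using ha
    obtain ⟨B, hB⟩ : ∏ a ∈ Finset.univ.filter fun a => f.eval a = γ, (X - C a) ∣
        C (T.derivative.eval γ) * f.derivative + N := by
      refine prod_X_sub_C_dvd_of_isRoot fun a ha => ?_
      have := eval_derivative_of_comp_eq hN a
      rw [(Finset.mem_filter.1 ha).2] at this
      simpa using this
    have hL := natDegree_finsetProd_X_sub_C_eq_card
      (Finset.univ.filter fun a => f.eval a = γ) (fun a : F => a)
    refine ⟨_, g, B, hg, hB, degree_lt_of_mul_degree_lt hg ?_, hL, ?_⟩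
    · rw [← hB, degree_sub_C_of_natDegree_pos hf]
      exact hAdeg _
    · have h0 := hne γ
      have hdeg := natDegree_sub_C (p := f) (a := γ)
      rw [hg] at h0 hdeg
      rw [natDegree_mul (left_ne_zero_of_mul h0) (right_ne_zero_of_mul h0), hL] at hdeg
      exact Nat.eq_sub_of_add_eq' hdeg
  have hl : ∀ γ, l γ ≤ f.natDegree := card_fiber_le_natDegree hf
  have hsum : ∑ γ ∈ S, (f.natDegree - l γ) < f.natDegree := by
    have hq : Fintype.card F = ∑ γ ∈ S, l γ :=
      Finset.card_eq_sum_card_fiberwise fun a _ => by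
        rw [← himage]; exact Finset.mem_coe.2 (Finset.mem_image_of_mem _ (Finset.mem_univ a))
    have : ∑ γ ∈ S, (f.natDegree - l γ) + ∑ γ ∈ S, l γ = S.card * f.natDegree := by
      rw [← Finset.sum_add_distrib, Finset.sum_congr rfl fun γ _ => Nat.sub_add_cancel (hl γ),
        Finset.sum_const, smul_eq_mul]
    rw [mul_comm] at hcard
    omega
  obtain ⟨γ₀, h₀, γ₁, h₁, γ₂, h₂, h₀₁, h₀₂, h₁₂⟩ := Finset.two_lt_card.1 hS
  have hsum₃ : (f.natDegree - l γ₀) + ((f.natDegree - l γ₁) + (f.natDegree - l γ₂)) <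
      f.natDegree := by
    refine lt_of_le_of_lt ?_ hsum
    have hsub : ({γ₀, γ₁, γ₂} : Finset F) ⊆ S := by
      simp [Finset.insert_subset_iff, h₀, h₁, h₂]
    have := Finset.sum_le_sum_of_subset (f := fun γ => f.natDegree - l γ) hsub
    rwa [Finset.sum_insert (by simp [h₀₁, h₀₂]), Finset.sum_pair h₁₂] at this
  obtain ⟨L₀, g₀, B₀, hg₀, hB₀, hd₀, -, hgd₀⟩ := hfactor γ₀
  obtain ⟨L₁, g₁, B₁, hg₁, hB₁, hd₁, hL₁, hgd₁⟩ := hfactor γ₁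
  obtain ⟨L₂, g₂, B₂, hg₂, hB₂, hd₂, hL₂, hgd₂⟩ := hfactor γ₂
  by_cases hc : T.derivative.eval γ₁ = T.derivative.eval γ₂
  · refine ⟨γ₁, h₁, ?_⟩
    have hcop : IsCoprime L₁ L₂ := by
      have := isCoprime_sub_C_sub_C f h₁₂
      rw [hg₁, hg₂] at this
      exact this.of_mul_left_left.of_mul_right_left
    have hdvd : L₁ * L₂ ∣ C (T.derivative.eval γ₁) * f.derivative + N :=
      hcop.mul_dvd (Dvd.intro _ hB₁.symm) (hc ▸ Dvd.intro _ hB₂.symm)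
    refine eq_zero_of_dvd_of_degree_lt hdvd ((hAdeg _).trans_le ?_)
    have hL₁0 : L₁ ≠ 0 := left_ne_zero_of_mul (hg₁ ▸ hne γ₁)
    have hL₂0 : L₂ ≠ 0 := left_ne_zero_of_mul (hg₂ ▸ hne γ₂)
    rw [degree_eq_natDegree hf0, degree_eq_natDegree (mul_ne_zero hL₁0 hL₂0),
      natDegree_mul hL₁0 hL₂0, Nat.cast_le, hL₁, hL₂]
    omega
  · refine ⟨γ₀, h₀, eq_zero_of_pencil_factors h₀₁ h₀₂ hc hg₀ hg₁ hg₂ hB₀ hB₁ hB₂ hd₀ hd₁ hd₂ ?_⟩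
    refine degree_lt_degree
      ((natDegree_mul_le.trans (Nat.add_le_add_right natDegree_mul_le _)).trans_lt ?_)
    omega

/-- Criterion for being a minimal value set polynomial with given
value set `S` (|S| > 2), where `T = ∏_{γ∈S} (X − γ)`:
`f` is an m.v.s.p. with `V_f = S` iff `T∘f = θ·(X^q − X)·f'` for some `θ ≠ 0`.
Moreover any such witness `θ` equals `−T'(γ)` for some `γ ∈ S`. -/
theorem stmt1 {F : Type*} [Field F] [Fintype F] [DecidableEq F] (q : ℕ)
    (hq : Fintype.card F = q) (S : Finset F) (hS : 2 < S.card)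
    (T : F[X]) (hT : T = ∏ γ ∈ S, (X - C γ))
    (f : F[X]) (hf : 0 < f.natDegree) :
    (((Finset.univ.image fun a => f.eval a) = S ∧
        (Finset.univ.image fun a => f.eval a).card = (q - 1) / f.natDegree + 1) ↔
      ∃ θ : F, θ ≠ 0 ∧ T.comp f = C θ * ((X ^ q - X) * f.derivative)) ∧
    ∀ θ : F, θ ≠ 0 → T.comp f = C θ * ((X ^ q - X) * f.derivative) →
      ∃ γ ∈ S, θ = -(T.derivative.eval γ) := by
  subst hq hT
  set T : F[X] := ∏ γ ∈ S, (X - C γ) with hT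
  have hTdeg : (T.comp f).natDegree = f.natDegree * S.card := by
    rw [natDegree_comp, hT, natDegree_finsetProd_X_sub_C_eq_card, mul_comm]
  have hTf : T.comp f ≠ 0 := fun h => by
    rw [h, natDegree_zero] at hTdeg
    exact (Nat.mul_pos hf (by omega)).ne hTdeg
  have hq1 : 1 < Fintype.card F := Fintype.one_lt_card
  have hle := card_le_natDegree_mul_card_image hf
  have hsolution : ∀ θ : F, T.comp f = C θ * ((X ^ Fintype.card F - X) * f.derivative) →
      f.derivative ≠ 0 ∧ f.natDegree * S.card = Fintype.card F + f.derivative.natDegree := by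
    intro θ h
    have hne := h ▸ hTf
    have hne' := right_ne_zero_of_mul hne
    have hder := right_ne_zero_of_mul hne'
    refine ⟨hder, ?_⟩
    rw [← hTdeg, h, natDegree_C_mul (fun h0 => hne (by rw [h0, C_0, zero_mul])),
      natDegree_mul (left_ne_zero_of_mul hne') hder,
      FiniteField.X_pow_card_sub_X_natDegree_eq F hq1]
  have hder_lt := natDegree_derivative_lt hf.ne'
  refine ⟨⟨?_, ?_⟩, ?_⟩
  · rintro ⟨himage, hcard⟩
    have hcard' : f.natDegree * S.card < Fintype.card F + f.natDegree := by
      rw [← himage, hcard, Nat.mul_add, mul_one]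
      have := Nat.mul_div_le (Fintype.card F - 1) f.natDegree
      omega
    obtain ⟨γ, -, h⟩ := exists_comp_eq_of_image_eq hS hf himage hcard'
    exact ⟨_, fun h0 => hTf (by rw [hT, h, h0, C_0, zero_mul]), h⟩
  · rintro ⟨θ, -, h⟩
    obtain ⟨-, hdeg⟩ := hsolution θ h
    have hsub : (Finset.univ.image fun a => f.eval a) ⊆ S := by
      intro b hb
      obtain ⟨a, -, rfl⟩ := Finset.mem_image.1 hb
      have h0 := congrArg (eval a) h
      simpa [hT, eval_comp, eval_prod, FiniteField.pow_card, Finset.prod_eq_zero_iff,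
        sub_eq_zero] using h0
    have himage : (Finset.univ.image fun a => f.eval a) = S := by
      refine Finset.eq_of_subset_of_card_le hsub ?_
      refine Nat.le_of_lt_succ (Nat.lt_of_mul_lt_mul_left (a := f.natDegree) ?_)
      rw [Nat.mul_succ]
      omega
    rw [himage] at hle ⊢
    refine ⟨rfl, ?_⟩
    obtain ⟨r, hr⟩ : ∃ r, S.card = r + 1 := ⟨S.card - 1, by omega⟩
    rw [hr] at hle hdeg ⊢
    rw [Nat.mul_succ] at hle hdeg
    rw [Nat.div_eq_of_lt_le (k := r)]
    · rw [mul_comm]; omega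
    · rw [Nat.succ_mul, mul_comm]; omega
  · intro θ _ h
    obtain ⟨hder, hdeg⟩ := hsolution θ h
    have hlt : f.derivative.natDegree < Fintype.card F := by nlinarith
    obtain ⟨a, ha⟩ : ∃ a, f.derivative.eval a ≠ 0 := by
      by_contra! hall
      exact hder (eq_zero_of_natDegree_lt_card_of_eval_eq_zero' _ Finset.univ
        (fun a _ => hall a) hlt)
    have h' : T.comp f = (X ^ Fintype.card F - X) * (C θ * f.derivative) := by
      rw [h]; ring
    refine ⟨f.eval a, ?_, ?_⟩
    · have h0 := congrArg (eval a) h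
      simpa [hT, eval_comp, eval_prod, FiniteField.pow_card, Finset.prod_eq_zero_iff,
        sub_eq_zero] using h0
    · have := eval_derivative_of_comp_eq h' a
      rw [eval_mul, eval_C, ← add_mul] at this
      linear_combination (mul_eq_zero.1 this).resolve_right ha
end

section
/- Let F be a finite field of characteristic p with q elements and let f ∈ F[X] be a minimal value set polynomial with |V_f| > 2. Then for every γ ∈ V_f and every root π of f − γ in an algebraic closure of F, the root π does not lie in F if and only if p divides the multiplicity of π as a root of f − γ. -/
open Polynomial

/-- Rational interpolation (linearised): on a set `s` with fewer than `m + n` points, every function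
`c` satisfies `A = c B` for suitable polynomials `A`, `B`, not both zero, with
`deg A < m` and `deg B < n`. -/
theorem exists_linearized_rational_interpolant {K : Type*} [Field K] (s : Finset K) (c : K → K)
    {m n : ℕ} (hm : 1 ≤ m) (hn : 1 ≤ n) (h : s.card < m + n) :
    ∃ A B : K[X], ¬(A = 0 ∧ B = 0) ∧ A.natDegree < m ∧ B.natDegree < n ∧
      ∀ x ∈ s, A.eval x = c x * B.eval x := by
  classical
  let L : ((Fin m → K) × (Fin n → K)) →ₗ[K] (s → K) :=
    LinearMap.pi fun x =>
      (leval (x : K)).comp ((ofFn m).comp (LinearMap.fst K _ _)) -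
        c x • (leval (x : K)).comp ((ofFn n).comp (LinearMap.snd K _ _))
  have hL : LinearMap.ker L ≠ ⊥ :=
    LinearMap.ker_ne_bot_of_finrank_lt (by simpa [Module.finrank_prod] using h)
  obtain ⟨v, hv, hv0⟩ := Submodule.exists_mem_ne_zero_of_ne_bot hL
  refine ⟨ofFn m v.1, ofFn n v.2, ?_, ofFn_natDegree_lt hm _, ofFn_natDegree_lt hn _, ?_⟩
  · rintro ⟨h1, h2⟩
    apply hv0
    ext i
    · simpa [h1] using (ofFn_coeff_eq_val_of_lt v.1 i.2).symm
    · simpa [h2] using (ofFn_coeff_eq_val_of_lt v.2 i.2).symm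
  · intro x hx
    have := congrFun (LinearMap.mem_ker.mp hv) ⟨x, hx⟩
    simpa [L, sub_eq_zero] using this

/-- If two nonzero polynomials of degree less than `deg f` have a ratio that is a rational function
of `f`, then this ratio is constant. -/
theorem exists_eq_C_mul_of_comp_mul_eq_comp_mul {K : Type*} [Field K] {f g h A B : K[X]}
    (hg : g ≠ 0) (hh : h ≠ 0) (hgf : g.natDegree < f.natDegree) (hhf : h.natDegree < f.natDegree)
    (hAB : ¬(A = 0 ∧ B = 0)) (e : A.comp f * g = B.comp f * h) :
    ∃ θ : K, θ ≠ 0 ∧ h = C θ * g := by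
  classical
  have comp_ne : ∀ {P : K[X]}, P ≠ 0 → P.comp f ≠ 0 := fun {P} hP hc => by
    rcases comp_eq_zero_iff.mp hc with h0 | ⟨-, h0⟩
    · exact hP h0
    · rw [h0, natDegree_C] at hgf
      exact Nat.not_lt_zero _ hgf
  have const_of_dvd : ∀ {P k : K[X]}, k ≠ 0 → k.natDegree < f.natDegree → P.comp f ∣ k →
      ∃ a, P = C a := fun {P k} hk hkf hd => by
    have hle := natDegree_le_of_dvd hd hk
    rw [natDegree_comp] at hle
    refine ⟨_, eq_C_of_natDegree_eq_zero ?_⟩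
    by_contra h0
    nlinarith [Nat.one_le_iff_ne_zero.mpr h0]
  let : GCDMonoid K[X] := EuclideanDomain.gcdMonoid K[X]
  have hD : gcd A B ≠ 0 := fun h0 => hAB ((gcd_eq_zero_iff _ _).mp h0)
  obtain ⟨a, b, hA, hB, hu⟩ := extract_gcd A B
  have e' : a.comp f * g = b.comp f * h := by
    apply mul_left_cancel₀ (comp_ne hD)
    rw [← mul_assoc, ← mul_assoc, ← mul_comp, ← mul_comp, ← hA, ← hB, e]
  have hco : IsCoprime (a.comp f) (b.comp f) :=
    ((_root_.gcd_isUnit_iff a b).mp hu).map (compRingHom f)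
  obtain ⟨α, rfl⟩ := const_of_dvd hh hhf (hco.dvd_of_dvd_mul_left ⟨g, e'.symm⟩)
  obtain ⟨β, rfl⟩ := const_of_dvd hg hgf (hco.symm.dvd_of_dvd_mul_left ⟨h, e'⟩)
  rw [C_comp, C_comp] at e'
  have hβ : β ≠ 0 := by
    rintro rfl
    have hα : α = 0 := by simpa [hg] using e'
    exact hAB ⟨hA.trans (by simp [hα]), hB.trans (by simp)⟩
  have hα : α ≠ 0 := by
    rintro rfl
    simp [hh, hβ] at e'
  refine ⟨β⁻¹ * α, mul_ne_zero (inv_ne_zero hβ) hα, ?_⟩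
  rw [C_mul, mul_assoc, e', ← mul_assoc, ← C_mul, inv_mul_cancel₀ hβ, C_1, one_mul]

/-- A polynomial vanishing on a finite field is divisible by `X ^ q - X`. -/
theorem FiniteField.X_pow_card_sub_X_dvd {F : Type*} [Field F] [Fintype F] {P : F[X]}
    (hP : ∀ a, P.eval a = 0) : (X ^ Fintype.card F - X : F[X]) ∣ P := by
  have hmonic : (X ^ Fintype.card F - X : F[X]).Monic :=
    monic_X_pow_sub (by rw [degree_X]; exact_mod_cast Fintype.one_lt_card)
  have hdeg := FiniteField.X_pow_card_sub_X_natDegree_eq F (Fintype.one_lt_card (α := F))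
  rw [← modByMonic_eq_zero_iff_dvd hmonic]
  refine eq_zero_of_natDegree_lt_card_of_eval_eq_zero _ Function.injective_id (fun a => ?_) ?_
  · have := congrArg (eval a) (modByMonic_add_div P (X ^ Fintype.card F - X : F[X]))
    simpa [hP, FiniteField.pow_card] using this
  · conv_rhs => rw [← hdeg]
    refine natDegree_modByMonic_lt P hmonic fun h1 => ?_
    rw [h1, natDegree_one] at hdeg
    exact Fintype.card_ne_zero hdeg.symm

/-- A minimal value set polynomial with more than two values satisfies the differential equation
`T(f) = θ (X ^ q - X) f'`, where `T` is the monic polynomial whose roots are the values of `f`. -/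
theorem exists_prod_comp_eq_of_minimal_value_set {F : Type*} [Field F] [Fintype F] [DecidableEq F]
    (f : F[X]) (hf : 0 < f.natDegree)
    (hmin : (Finset.univ.image fun a => f.eval a).card =
      (Fintype.card F - 1) / f.natDegree + 1)
    (hV : 2 < (Finset.univ.image fun a => f.eval a).card) :
    ∃ θ : F, θ ≠ 0 ∧ ∏ γ ∈ Finset.univ.image (fun a => f.eval a), (f - C γ) =
      C θ * ((X ^ Fintype.card F - X) * derivative f) := by
  set V := Finset.univ.image fun a => f.eval a
  set q := Fintype.card F with hq
  set d := f.natDegree with hd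
  set r := (q - 1) / d
  have hq1 : 1 < q := Fintype.one_lt_card
  have hrd : r * d ≤ q - 1 := Nat.div_mul_le_self _ _
  have hdr : d ≤ r * d := Nat.le_mul_of_pos_left d (by omega)
  set T : F[X] := ∏ γ ∈ V, (X - C γ) with hT
  have hTf : T.comp f = ∏ γ ∈ V, (f - C γ) := by simp [hT, prod_comp]
  have hTdeg : (T.comp f).natDegree = (r + 1) * d := by
    rw [natDegree_comp, hT, natDegree_prod_of_monic _ _ fun γ _ => monic_X_sub_C γ]
    simp [hmin, hd]
  have hT0 : T.comp f ≠ 0 := fun h0 => by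
    rw [h0, natDegree_zero] at hTdeg
    have := Nat.mul_pos (Nat.succ_pos r) hf
    rw [Nat.succ_eq_add_one] at this
    omega
  obtain ⟨G, hG⟩ : (X ^ q - X : F[X]) ∣ T.comp f := by
    refine FiniteField.X_pow_card_sub_X_dvd fun a => ?_
    rw [hTf, eval_prod]
    exact Finset.prod_eq_zero (Finset.mem_image_of_mem _ (Finset.mem_univ a)) (by simp)
  have hG0 : G ≠ 0 := fun h0 => hT0 (by rw [hG, h0, mul_zero])
  have hGdeg : G.natDegree < d := by
    have := hTdeg
    rw [hG, natDegree_mul (FiniteField.X_pow_card_sub_X_ne_zero F hq1) hG0,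
      FiniteField.X_pow_card_sub_X_natDegree_eq F hq1, add_mul, one_mul] at this
    omega
  have hGeval : ∀ a, G.eval a = -(((derivative T).eval (f.eval a)) * (derivative f).eval a) := by
    intro a
    have := congrArg (fun P => (derivative P).eval a) hG
    simp only [derivative_comp, derivative_mul, derivative_sub, derivative_X_pow, derivative_X,
      eval_mul, eval_add, eval_sub, eval_pow, eval_X, eval_comp, eval_one, eval_C, hq,
      FiniteField.pow_card, FiniteField.cast_card_eq_zero] at this
    linear_combination this
  have hf' : derivative f ≠ 0 := fun h0 => hG0 <|
    eq_zero_of_natDegree_lt_card_of_eval_eq_zero G Function.injective_id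
      (fun a => by simp [hGeval, h0]) (by omega)
  have hf'deg : (derivative f).natDegree < d := natDegree_derivative_lt hf.ne'
  obtain ⟨A, B, hAB, hA, hB, hABV⟩ := exists_linearized_rational_interpolant V
    (fun γ => -(derivative T).eval γ) (m := 2) (n := r) (by omega) (by omega) (by omega)
  obtain ⟨A, B, hAB, hA, hB, hABV⟩ : ∃ A B : F[X], ¬(A = 0 ∧ B = 0) ∧ A.natDegree < r ∧
      B.natDegree < r ∧ ∀ γ ∈ V, A.eval γ = -(derivative T).eval γ * B.eval γ :=
    ⟨A, B, hAB, by omega, hB, hABV⟩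
  have hcomp : ∀ P k : F[X], P.natDegree < r → k.natDegree < d →
      (P.comp f * k).natDegree < q := fun P k hP hk => by
    have h1 : (P.comp f * k).natDegree ≤ P.natDegree * d + k.natDegree := by
      simpa [natDegree_comp] using natDegree_mul_le (p := P.comp f) (q := k)
    have h2 : (P.natDegree + 1) * d ≤ r * d := Nat.mul_le_mul_right d hP
    rw [add_mul, one_mul] at h2
    omega
  have key : A.comp f * derivative f = B.comp f * G := by
    refine eq_of_natDegree_lt_card_of_eval_eq _ _ Function.injective_id (fun a => ?_)
      (max_lt (hcomp A _ hA hf'deg) (hcomp B _ hB hGdeg))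
    have := hABV _ (Finset.mem_image_of_mem _ (Finset.mem_univ a))
    simp only [id, eval_mul, eval_comp, hGeval, this]
    ring
  obtain ⟨θ, hθ, hGθ⟩ := exists_eq_C_mul_of_comp_mul_eq_comp_mul hf' hG0 hf'deg hGdeg hAB key
  exact ⟨θ, hθ, by rw [← hTf, hG, hGθ]; ring⟩

/-- A root multiplicity divisible by the characteristic does not drop under differentiation. -/
theorem Polynomial.rootMultiplicity_le_derivative_of_dvd {K : Type*} [Field K] (p : ℕ) [CharP K p]
    {P : K[X]} {x : K} (hP : derivative P ≠ 0) (h : p ∣ P.rootMultiplicity x) :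
    P.rootMultiplicity x ≤ (derivative P).rootMultiplicity x := by
  rw [le_rootMultiplicity_iff hP]
  obtain ⟨g, hg⟩ := P.pow_rootMultiplicity_dvd x
  set m := P.rootMultiplicity x
  have hm : (m : K) = 0 := (CharP.cast_eq_zero_iff K p m).mpr h
  exact ⟨derivative g, by rw [hg]; simp [derivative_mul, derivative_X_sub_C_pow, hm]⟩

/-- In an extension of a finite field, the roots of `X ^ q - X` are the elements of the field. -/
theorem FiniteField.pow_card_eq_self_iff_mem_range {F K : Type*} [Field F] [Fintype F] [Field K]
    [Algebra F K] (x : K) : x ^ Fintype.card F = x ↔ x ∈ Set.range (algebraMap F K) := by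
  classical
  constructor
  · intro hx
    have hcard : (Finset.univ.map ⟨algebraMap F K, (algebraMap F K).injective⟩).card =
      Fintype.card F := by simp
    by_contra hmem
    apply FiniteField.X_pow_card_sub_X_ne_zero K (Fintype.one_lt_card (α := F))
    refine eq_zero_of_natDegree_lt_card_of_eval_eq_zero' _
      (insert x (Finset.univ.map ⟨algebraMap F K, (algebraMap F K).injective⟩)) ?_ ?_
    · intro y hy
      rcases Finset.mem_insert.mp hy with rfl | hy
      · simp [hx]
      · obtain ⟨a, -, rfl⟩ := Finset.mem_map.mp hy
        simp [← map_pow, FiniteField.pow_card]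
    · rw [FiniteField.X_pow_card_sub_X_natDegree_eq K Fintype.one_lt_card,
        Finset.card_insert_of_notMem, hcard]
      · exact Nat.lt_succ_self _
      · simpa using hmem
  · rintro ⟨a, rfl⟩
    rw [← map_pow, FiniteField.pow_card]

/-- Let `f` be a minimal value set polynomial over `F` with more than two values. A root `π` of
`f - γ`, for `γ` a value of `f`, in an extension of `F` lies outside `F` iff its multiplicity is
divisible by the characteristic. -/
theorem notMem_range_iff_dvd_rootMultiplicity_of_minimal_value_set {F K : Type*} [Field F]
    [Fintype F] [DecidableEq F] [Field K] [Algebra F K] (p : ℕ) [CharP F p]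
    (f : F[X]) (hf : 0 < f.natDegree)
    (hmvsp : (Finset.univ.image fun a => f.eval a).card =
      (Fintype.card F - 1) / f.natDegree + 1)
    (hV : 2 < (Finset.univ.image fun a => f.eval a).card)
    (γ : F) (hγ : γ ∈ Finset.univ.image fun a => f.eval a) (π : K)
    (hπ : (f.map (algebraMap F K) - C (algebraMap F K γ)).eval π = 0) :
    π ∉ Set.range (algebraMap F K) ↔
      p ∣ rootMultiplicity π (f.map (algebraMap F K) - C (algebraMap F K γ)) := by
  set φ := algebraMap F K
  have : CharP K p := charP_of_injective_algebraMap φ.injective p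
  obtain ⟨θ, hθ, hode⟩ := exists_prod_comp_eq_of_minimal_value_set f hf hmvsp hV
  set V := Finset.univ.image fun a => f.eval a
  set P := f.map φ - C (φ γ) with hPdef
  have hroot : P.IsRoot π := hπ
  have hPdeg : P.natDegree = f.natDegree := by rw [hPdef, natDegree_sub_C, natDegree_map]
  have hP0 : P ≠ 0 := fun h0 => by simp [h0] at hPdeg; omega
  have hmpos : 0 < P.rootMultiplicity π := (rootMultiplicity_pos hP0).mpr hroot
  set R := ∏ γ' ∈ V.erase γ, (f.map φ - C (φ γ'))
  have hR : R.eval π ≠ 0 := by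
    rw [eval_prod, Finset.prod_ne_zero_iff]
    intro γ' hγ' h0
    refine Finset.ne_of_mem_erase hγ' (φ.injective ?_)
    rw [eval_sub, eval_C] at h0 hπ
    exact (sub_eq_zero.mp h0).symm.trans (sub_eq_zero.mp hπ)
  have hR0 : R ≠ 0 := fun h0 => hR (by rw [h0, eval_zero])
  have hPR : P * R = C (φ θ) * ((X ^ Fintype.card F - X) * derivative P) := by
    have := congrArg (Polynomial.map φ) hode
    rw [← Finset.mul_prod_erase _ _ hγ] at this
    simpa [Polynomial.map_prod, hPdef, R, derivative_map] using this
  have hne : C (φ θ) * ((X ^ Fintype.card F - X) * derivative P) ≠ 0 :=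
    hPR ▸ mul_ne_zero hP0 hR0
  have hne' := right_ne_zero_of_mul hne
  have hP' : derivative P ≠ 0 := right_ne_zero_of_mul hne'
  have hX : (X ^ Fintype.card F - X : K[X]) ≠ 0 := left_ne_zero_of_mul hne'
  have hmult : P.rootMultiplicity π = (X ^ Fintype.card F - X : K[X]).rootMultiplicity π +
      (derivative P).rootMultiplicity π := by
    have := congrArg (rootMultiplicity π) hPR
    rwa [rootMultiplicity_mul (mul_ne_zero hP0 hR0), rootMultiplicity_eq_zero hR, add_zero,
      rootMultiplicity_mul hne, rootMultiplicity_C, zero_add, rootMultiplicity_mul hne'] at this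
  have hmem : π ∈ Set.range φ ↔ 0 < (X ^ Fintype.card F - X : K[X]).rootMultiplicity π := by
    rw [rootMultiplicity_pos hX, ← FiniteField.pow_card_eq_self_iff_mem_range]
    simp [sub_eq_zero]
  rw [hmem]
  constructor
  · intro h
    by_contra hpm
    have := derivative_rootMultiplicity_of_root_of_mem_nonZeroDivisors hroot
      (mem_nonZeroDivisors_of_ne_zero fun h0 => hpm ((CharP.cast_eq_zero_iff K p _).mp h0))
    omega
  · intro h
    have := rootMultiplicity_le_derivative_of_dvd p hP' h
    omega

/-- Let `f` be a minimal value set polynomial over a finite field `F`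
of characteristic `p` with `|V_f| > 2`. For every `γ ∈ V_f` and every root `π` of
`f − γ` in an algebraic closure of `F`, `π` does not lie in `F` iff `p` divides the
multiplicity of `π` as a root of `f − γ`. -/
theorem stmt3 {F : Type*} [Field F] [Fintype F] [DecidableEq F] (p q : ℕ)
    (hp : p.Prime) [CharP F p] (hq : Fintype.card F = q)
    (f : F[X]) (hf : 0 < f.natDegree)
    (hmvsp : (Finset.univ.image fun a => f.eval a).card = (q - 1) / f.natDegree + 1)
    (hV : 2 < (Finset.univ.image fun a => f.eval a).card)
    (γ : F) (hγ : γ ∈ Finset.univ.image fun a => f.eval a)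
    (π : AlgebraicClosure F)
    (hπ : (f.map (algebraMap F (AlgebraicClosure F)) -
      C (algebraMap F (AlgebraicClosure F) γ)).eval π = 0) :
    π ∉ Set.range (algebraMap F (AlgebraicClosure F)) ↔
      p ∣ Polynomial.rootMultiplicity π
        (f.map (algebraMap F (AlgebraicClosure F)) -
          C (algebraMap F (AlgebraicClosure F) γ)) := by
  subst hq
  exact notMem_range_iff_dvd_rootMultiplicity_of_minimal_value_set p f hf hmvsp hV γ hγ π hπ
end

section
/- Let F be a finite field with q elements and let f ∈ F[X] be a minimal value set polynomial with |V_f| > 2 and deg f ≤ √q. If g ∈ F[X] is a minimal value set polynomial with deg g ≤ √q and V_g = V_f, then there exist a, b ∈ F such that g = f∘(a·X + b). -/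
open Polynomial

/-- If `d < e` and `e² ≤ q`, then the quotients `(q - 1) / d` and `(q - 1) / e` differ. -/
theorem not_lt_of_div_eq_div_of_sq_le {q d e : ℕ} (hq : 0 < q) (hd : 0 < d) (he : e ^ 2 ≤ q)
    (h : (q - 1) / d = (q - 1) / e) : ¬ d < e := by
  intro hlt
  have h1 : q - 1 < d * ((q - 1) / d + 1) := Nat.lt_mul_div_succ _ hd
  have h2 : e * ((q - 1) / e) ≤ q - 1 := Nat.mul_div_le _ _
  rw [← h] at h2
  generalize (q - 1) / d = r at h1 h2
  obtain ⟨n, rfl⟩ : ∃ n, q = n + 1 := ⟨q - 1, by omega⟩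
  obtain ⟨k, rfl⟩ : ∃ k, e = d + 1 + k := ⟨e - d - 1, by omega⟩
  simp only [Nat.add_sub_cancel] at h1 h2
  have hr : r + 1 ≤ d + k := by nlinarith
  nlinarith [Nat.mul_le_mul_left d hr]

/-- The numerical condition under which the points of `f(x) = g(y)` outnumber
`(d - 1)(q - 1)`. -/
theorem sq_mul_div_succ_lt {q d : ℕ} (hq : 1 < q) (hd : 0 < d) (hdq : d ^ 2 ≤ q) :
    d ^ 2 * ((q - 1) / d + 1) + d < q + d * q := by
  have h : d * ((q - 1) / d) ≤ q - 1 := Nat.mul_div_le _ _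
  generalize (q - 1) / d = r at h
  obtain ⟨n, rfl⟩ : ∃ n, q = n + 1 := ⟨q - 1, by omega⟩
  simp only [Nat.add_sub_cancel] at h
  rcases h.lt_or_eq with h | rfl
  · nlinarith [Nat.mul_le_mul_left d (Nat.succ_le_of_lt h)]
  · rcases hdq.lt_or_eq with h' | h'
    · nlinarith
    · have hdvd : d ∣ 1 := (Nat.dvd_add_right (Dvd.intro r rfl)).1 (h' ▸ dvd_pow_self d two_ne_zero)
      obtain rfl := Nat.dvd_one.1 hdvd
      omega

theorem Polynomial.card_filter_eval_eq_le {F : Type*} [Field F] [Fintype F] [DecidableEq F]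
    {f : F[X]} (hf : 0 < f.natDegree) (c : F) :
    (Finset.univ.filter fun x => f.eval x = c).card ≤ f.natDegree := by
  have hne : f - C c ≠ 0 := by
    intro h
    rw [sub_eq_zero.1 h, natDegree_C] at hf
    exact hf.false
  rw [← natDegree_sub_C (p := f) (a := c)]
  refine card_le_degree_of_subset_roots fun x hx => ?_
  have hx' : f.eval x = c := by simpa using hx
  rw [mem_roots hne]
  simp [IsRoot, hx']

/-- Lower bound for the number of rational points of `f(x) = g(y)`, for polynomials of the same
degree with a common value set. -/
theorem Polynomial.two_mul_card_le_card_eval_eq {F : Type*} [Field F] [Fintype F] [DecidableEq F]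
    {f g : F[X]} {d : ℕ} (hd : 0 < d) (hf : f.natDegree = d) (hg : g.natDegree = d)
    (hV : (Finset.univ.image fun a => g.eval a) = Finset.univ.image fun a => f.eval a) :
    2 * d * Fintype.card F ≤
      (Finset.univ.filter fun z : F × F => f.eval z.1 = g.eval z.2).card +
        d ^ 2 * (Finset.univ.image fun a => f.eval a).card := by
  set V := Finset.univ.image fun a => f.eval a with hVdef
  have hfs : Fintype.card F = ∑ c ∈ V, (Finset.univ.filter fun x => f.eval x = c).card :=
    Finset.card_eq_sum_card_fiberwise fun x _ => by simp [hVdef]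
  have hgs : Fintype.card F = ∑ c ∈ V, (Finset.univ.filter fun x => g.eval x = c).card :=
    Finset.card_eq_sum_card_fiberwise fun x _ => by simp [← hV]
  have hN : (Finset.univ.filter fun z : F × F => f.eval z.1 = g.eval z.2).card =
      ∑ c ∈ V, (Finset.univ.filter fun x => f.eval x = c).card *
        (Finset.univ.filter fun x => g.eval x = c).card := by
    rw [Finset.card_eq_sum_card_fiberwise (f := fun z : F × F => f.eval z.1) (t := V)
      fun z _ => by simp [hVdef]]
    refine Finset.sum_congr rfl fun c _ => ?_
    rw [← Finset.card_product]
    congr 1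
    ext z
    simp only [Finset.mem_filter, Finset.mem_univ, true_and, Finset.mem_product]
    constructor
    · rintro ⟨h, rfl⟩
      exact ⟨rfl, h.symm⟩
    · rintro ⟨h, h'⟩
      exact ⟨h.trans h'.symm, h⟩
  have hsum : 2 * d * Fintype.card F = ∑ c ∈ V, d *
      ((Finset.univ.filter fun x => f.eval x = c).card +
        (Finset.univ.filter fun x => g.eval x = c).card) := by
    rw [← Finset.mul_sum, Finset.sum_add_distrib, ← hfs, ← hgs]
    ring
  have hconst : d ^ 2 * V.card = ∑ _c ∈ V, d ^ 2 := by
    rw [Finset.sum_const, smul_eq_mul, mul_comm]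
  rw [hN, hsum, hconst, ← Finset.sum_add_distrib]
  refine Finset.sum_le_sum fun c _ => ?_
  obtain ⟨u, hu⟩ := Nat.exists_eq_add_of_le
    (hf ▸ card_filter_eval_eq_le (hf ▸ hd) c : (Finset.univ.filter fun x => f.eval x = c).card ≤ d)
  obtain ⟨v, hv⟩ := Nat.exists_eq_add_of_le
    (hg ▸ card_filter_eval_eq_le (hg ▸ hd) c : (Finset.univ.filter fun x => g.eval x = c).card ≤ d)
  generalize (Finset.univ.filter fun x => f.eval x = c).card = m at *
  generalize (Finset.univ.filter fun x => g.eval x = c).card = n at *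
  zify at *
  nlinarith [mul_nonneg u.cast_nonneg (α := ℤ) v.cast_nonneg]

/-- If `f(x) = g(y)` has more than `(d - 1)(q - 1) + 2d - 1` rational points, then it contains
a line. -/
theorem Polynomial.exists_eq_comp_linear_of_card_lt {F : Type*} [Field F] [Fintype F]
    [DecidableEq F] {f g : F[X]} {d : ℕ} (hd : 0 < d) (hf : f.natDegree = d)
    (hg : g.natDegree = d)
    (hV : (Finset.univ.image fun a => g.eval a) = Finset.univ.image fun a => f.eval a)
    (hN : (d - 1) * (Fintype.card F - 1) + 2 * d <
      (Finset.univ.filter fun z : F × F => f.eval z.1 = g.eval z.2).card + 1) :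
    ∃ a b : F, g = f.comp (C a * X + C b) := by
  obtain ⟨y₀, hy₀⟩ : ∃ y₀, g.eval y₀ = f.eval 0 := by
    have h : f.eval 0 ∈ Finset.univ.image fun a => g.eval a := by simp [hV]
    simpa using h
  set A := Finset.univ.filter fun z : F × F => f.eval z.1 = g.eval z.2 with hA
  set A₁ := A.filter fun z => z.1 = 0 with hA₁
  set A₂ := A.filter fun z => z.2 = y₀ with hA₂
  have h₁ : A₁.card ≤ d := by
    refine le_trans ?_ (hg ▸ card_filter_eval_eq_le (hg ▸ hd) (f.eval 0))
    refine Finset.card_le_card_of_injOn Prod.snd ?_ ?_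
    · rintro ⟨x, y⟩ hz
      simp [hA, hA₁] at hz ⊢
      rw [← hz.1, hz.2]
    · rintro ⟨x, y⟩ hz ⟨x', y'⟩ hz' h
      simp [hA, hA₁] at hz hz' h
      simp [hz.2, hz'.2, h]
  have h₂ : A₂.card ≤ d := by
    refine le_trans ?_ (hf ▸ card_filter_eval_eq_le (hf ▸ hd) (g.eval y₀))
    refine Finset.card_le_card_of_injOn Prod.fst ?_ ?_
    · rintro ⟨x, y⟩ hz
      simp [hA, hA₂] at hz ⊢
      rw [hz.1, hz.2]
    · rintro ⟨x, y⟩ hz ⟨x', y'⟩ hz' h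
      simp [hA, hA₂] at hz hz' h
      simp [hz.2, hz'.2, h]
  have h₃ : 0 < (A₁ ∩ A₂).card :=
    Finset.card_pos.2 ⟨(0, y₀), by simp [hA, hA₁, hA₂, hy₀]⟩
  have h₄ := Finset.card_union_add_card_inter A₁ A₂
  have h₅ : A.card ≤ (A \ (A₁ ∪ A₂)).card + (A₁ ∪ A₂).card :=
    Nat.sub_le_iff_le_add.1 (Finset.le_card_sdiff _ _)
  have hS : (d - 1) * (Fintype.card F - 1) < (A \ (A₁ ∪ A₂)).card := by omega
  have hmem : ∀ z ∈ A \ (A₁ ∪ A₂), f.eval z.1 = g.eval z.2 ∧ z.1 ≠ 0 ∧ z.2 ≠ y₀ := by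
    intro z hz
    simp only [hA₁, hA₂, hA, Finset.mem_sdiff, Finset.mem_union, Finset.mem_filter,
      Finset.mem_univ, true_and] at hz
    tauto
  obtain ⟨c, hc, hcard⟩ : ∃ c ∈ Finset.univ.erase (0 : F),
      d - 1 < ((A \ (A₁ ∪ A₂)).filter fun z => (z.2 - y₀) / z.1 = c).card := by
    refine Finset.exists_lt_card_fiber_of_mul_lt_card_of_maps_to (fun z hz => ?_) ?_
    · obtain ⟨-, hx, hy⟩ := hmem z hz
      simpa using ⟨sub_ne_zero.2 hy, hx⟩
    · rwa [Finset.card_erase_of_mem (Finset.mem_univ _), Finset.card_univ, mul_comm]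
  have hc0 : c ≠ 0 := Finset.ne_of_mem_erase hc
  set L := (A \ (A₁ ∪ A₂)).filter fun z => (z.2 - y₀) / z.1 = c with hL
  have hmemL : ∀ z ∈ L, f.eval z.1 = g.eval z.2 ∧ z.1 ≠ 0 ∧ z.2 = c * z.1 + y₀ := by
    intro z hz
    obtain ⟨hz, hzc⟩ := Finset.mem_filter.1 hz
    obtain ⟨h, hx, -⟩ := hmem z hz
    refine ⟨h, hx, ?_⟩
    rw [div_eq_iff hx] at hzc
    rw [← hzc, sub_add_cancel]
  have hline : f = g.comp (C c * X + C y₀) := by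
    have hinj : Set.InjOn Prod.fst (L : Set (F × F)) := by
      intro z hz z' hz' h
      refine Prod.ext h ?_
      rw [(hmemL z hz).2.2, (hmemL z' hz').2.2, h]
    have h0 : (0 : F) ∉ L.image Prod.fst := by
      intro h
      obtain ⟨z, hz, hz0⟩ := Finset.mem_image.1 h
      exact (hmemL z hz).2.1 hz0
    refine eq_of_natDegree_lt_card_of_eval_eq' _ _ (insert 0 (L.image Prod.fst)) ?_ ?_
    · intro x hx
      rcases Finset.mem_insert.1 hx with rfl | hx
      · simp [hy₀]
      · obtain ⟨z, hz, rfl⟩ := Finset.mem_image.1 hx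
        obtain ⟨h, -, h'⟩ := hmemL z hz
        simp [h, h']
    · rw [Finset.card_insert_of_notMem h0, Finset.card_image_of_injOn hinj, natDegree_comp,
        natDegree_linear hc0, hf, hg]
      omega
  refine ⟨c⁻¹, -(c⁻¹ * y₀), ?_⟩
  have hinv : (C c * X + C y₀).comp (C c⁻¹ * X + C (-(c⁻¹ * y₀))) = X := by
    simp only [add_comp, mul_comp, C_comp, X_comp, mul_add, ← mul_assoc, ← C_mul,
      mul_inv_cancel₀ hc0, mul_neg, C_neg, one_mul, C_1]
    ring
  rw [hline, comp_assoc, hinv, comp_X]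



/-- Minimal value set polynomials of degree `≤ √q` (i.e. with
`(deg f)² ≤ q`) are unique up to an affine composition once their value set is
fixed: if `f, g` are m.v.s.p.'s of degree `≤ √q`, `|V_f| > 2` and `V_g = V_f`, then
`g = f∘(aX + b)` for some `a, b ∈ F`. -/
theorem stmt5 {F : Type*} [Field F] [Fintype F] [DecidableEq F] (q : ℕ)
    (hq : Fintype.card F = q) (f g : F[X])
    (hf : 0 < f.natDegree) (hg : 0 < g.natDegree)
    (hfm : (Finset.univ.image fun a => f.eval a).card = (q - 1) / f.natDegree + 1)
    (hfV : 2 < (Finset.univ.image fun a => f.eval a).card)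
    (hfd : f.natDegree ^ 2 ≤ q)
    (hgm : (Finset.univ.image fun a => g.eval a).card = (q - 1) / g.natDegree + 1)
    (hgd : g.natDegree ^ 2 ≤ q)
    (hVg : (Finset.univ.image fun a => g.eval a) = Finset.univ.image fun a => f.eval a) :
    ∃ a b : F, g = f.comp (C a * X + C b) := by
  subst hq
  have hq : 1 < Fintype.card F := Fintype.one_lt_card
  rw [hVg, hfm] at hgm
  have hdiv : (Fintype.card F - 1) / f.natDegree = (Fintype.card F - 1) / g.natDegree :=
    Nat.add_right_cancel hgm
  have hdeg : g.natDegree = f.natDegree := le_antisymm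
    (not_lt.1 (not_lt_of_div_eq_div_of_sq_le (by omega) hf hgd hdiv))
    (not_lt.1 (not_lt_of_div_eq_div_of_sq_le (by omega) hg hfd hdiv.symm))
  refine exists_eq_comp_linear_of_card_lt hf rfl hdeg hVg ?_
  have hN := two_mul_card_le_card_eval_eq hf rfl hdeg hVg
  have hlt := sq_mul_div_succ_lt hq hf hfd
  rw [hfm] at hN
  obtain ⟨k, hk⟩ : ∃ k, f.natDegree = k + 1 := ⟨f.natDegree - 1, by omega⟩
  obtain ⟨n, hn⟩ : ∃ n, Fintype.card F = n + 1 := ⟨Fintype.card F - 1, by omega⟩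
  generalize (Fintype.card F - 1) / f.natDegree = r at *
  rw [hk, hn] at hN hlt ⊢
  simp only [Nat.add_sub_cancel]
  nlinarith
end

section
/- Let F be a finite field of characteristic p with q elements and let T ∈ F[X] be a monic polynomial of degree > 2 having deg T distinct roots, all lying in F. If there exist a non-constant f ∈ F[X] and a nonzero θ ∈ F such that T∘f = θ·(X^q − X)·f′, then there exist positive integers k, m, v with v dividing p^k − 1, and elements γ, ω_0, ω_1, …, ω_m ∈ F, such that T∘(X^v + γ) = X^{v−1}·(Σ_{i=0}^{m} ω_i X^{p^{ki}}). -/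
open Polynomial

set_option linter.unusedSectionVars false

section PrimeCharacteristic

variable {F : Type*} [Field F] {p : ℕ} [Fact p.Prime] [CharP F p]

theorem derivative_pow_char_pow (g : F[X]) {k : ℕ} (hk : k ≠ 0) :
    derivative (g ^ p ^ k) = 0 := by
  obtain ⟨k, rfl⟩ := Nat.exists_eq_succ_of_ne_zero hk
  rw [derivative_pow]
  simp [pow_succ]

theorem derivative_pow_char (g : F[X]) : derivative (g ^ p) = 0 := by
  simpa using derivative_pow_char_pow (p := p) g one_ne_zero

theorem exists_pow_char_eq_of_derivative_eq_zero [Finite F] {g : F[X]}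
    (hg : derivative g = 0) : ∃ h : F[X], h ^ p = g := by
  have hp : p ≠ 0 := (Fact.out : p.Prime).ne_zero
  refine ⟨map ((frobeniusEquiv F p).symm : F →+* F) (contract p g), ?_⟩
  rw [← map_frobenius_expand, ← map_expand, expand_contract p hg hp, map_map]
  have : (frobenius F p).comp ((frobeniusEquiv F p).symm : F →+* F) = RingHom.id F := by
    ext x
    simp
  rw [this, map_id]

theorem eq_of_pow_char_pow_eq {g h : F[X]} {k : ℕ} (H : g ^ p ^ k = h ^ p ^ k) : g = h := by
  rw [← sub_eq_zero]
  refine pow_eq_zero_iff (n := p ^ k) (pow_ne_zero _ (Fact.out : p.Prime).ne_zero) |>.1 ?_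
  rw [sub_pow_char_pow, H, sub_self]

theorem exists_eq_X_pow_mul {g : F[X]} (hg : g ≠ 0) :
    ∃ (m : ℕ) (K : F[X]), g = X ^ m * K ∧ K.coeff 0 ≠ 0 := by
  obtain ⟨K, h, hK⟩ := exists_eq_pow_rootMultiplicity_mul_and_not_dvd g hg 0
  rw [C_0, sub_zero] at h hK
  exact ⟨_, K, h, fun h0 => hK (X_dvd_iff.2 h0)⟩

theorem comp_ne_zero_of_natDegree_pos {f g : F[X]} (hf : 0 < f.natDegree) (hg : g ≠ 0) :
    g.comp f ≠ 0 := by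
  intro h0
  rcases comp_eq_zero_iff.1 h0 with h1 | ⟨-, h1⟩
  · exact hg h1
  · rw [h1] at hf
    simp at hf

theorem isCoprime_C {a : F} (ha : a ≠ 0) (g : F[X]) : IsCoprime g (C a) :=
  ⟨0, C a⁻¹, by rw [zero_mul, zero_add, ← C_mul, inv_mul_cancel₀ ha, C_1]⟩

/-- The weighted Euler operator `i K + v X K'`. -/
noncomputable def weightedEuler (i v : ℕ) (K : F[X]) : F[X] :=
  C (i : F) * K + C (v : F) * (X * derivative K)

theorem weightedEuler_coeff_zero (i v : ℕ) (K : F[X]) :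
    (weightedEuler i v K).coeff 0 = i * K.coeff 0 := by
  simp [weightedEuler]

theorem natDegree_weightedEuler_le (i v : ℕ) (K : F[X]) :
    (weightedEuler i v K).natDegree ≤ K.natDegree := by
  refine natDegree_add_le_of_degree_le (natDegree_C_mul_le _ _) ?_
  refine (natDegree_C_mul_le _ _).trans ?_
  rcases eq_or_ne K.natDegree 0 with h | h
  · rw [eq_C_of_natDegree_eq_zero h]; simp
  · refine natDegree_mul_le.trans ?_
    have := natDegree_derivative_lt h
    rw [natDegree_X]; omega

theorem dvd_and_exists_pow_of_weightedEuler_eq_zero [Finite F] {i v : ℕ} {K : F[X]}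
    (hv : (v : F) ≠ 0) (hK : K.coeff 0 ≠ 0) (h : weightedEuler i v K = 0) :
    p ∣ i ∧ ∃ K₁ : F[X], K₁ ^ p = K := by
  have h0 : (i : F) = 0 := by
    have := weightedEuler_coeff_zero i v K
    rw [h] at this
    simpa [hK] using this.symm
  refine ⟨(CharP.cast_eq_zero_iff F p i).1 h0, exists_pow_char_eq_of_derivative_eq_zero ?_⟩
  rw [weightedEuler, h0, C_0, zero_mul, zero_add] at h
  exact (mul_eq_zero.1 ((mul_eq_zero.1 h).resolve_left (C_ne_zero.2 hv))).resolve_left X_ne_zero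

theorem mul_derivative_pow (g : F[X]) (i : ℕ) :
    g * derivative (g ^ i) = C (i : F) * g ^ i * derivative g := by
  cases i with
  | zero => simp
  | succ i => rw [derivative_pow]; simp; ring

/-- An intermediate state of the descent: `S` has been split into a part `S₀` whose exponents `n`
make `v n + 1` a power of `p`, and a remainder whose exponents make `v n + 1` divisible by
`p ^ j`. -/
structure Stage (p s : ℕ) (c : F) (v : ℕ) (f S : F[X]) (j i ν : ℕ) (L N B E R : F[X]) : Prop where
  f_eq : f = L ^ v * N ^ p ^ j
  deriv_L : derivative L = B ^ p ^ j
  B_ne : B ≠ 0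
  N_ne : N ≠ 0
  v_ne : (v : F) ≠ 0
  S_eq : ∃ S₀ : F[X], S = S₀ + C c * X ^ ν * R ^ p ^ j ∧
    ∀ n ∈ S₀.support, ∃ a, v * n + 1 = p ^ a
  R_zero : R.coeff 0 ≠ 0
  idx : v * ν + 1 = i * p ^ j
  eqn : L ^ i * N ^ ν * R.comp f = X ^ p ^ (s - j) * B + E

namespace Stage

variable {s : ℕ} {c : F} {v : ℕ} {f S : F[X]} {j i ν : ℕ} {L N B E R : F[X]}

theorem v_pos (h : Stage p s c v f S j i ν L N B E R) : 0 < v := by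
  rcases Nat.eq_zero_or_pos v with h0 | h0
  · exact absurd (by simp [h0]) h.v_ne
  · exact h0

theorem i_pos (h : Stage p s c v f S j i ν L N B E R) : 0 < i := by
  rcases Nat.eq_zero_or_pos i with h0 | h0
  · have := h.idx; simp [h0] at this
  · exact h0

theorem L_ne (h : Stage p s c v f S j i ν L N B E R) : L ≠ 0 := by
  rintro rfl
  have := h.deriv_L
  rw [derivative_zero] at this
  exact pow_ne_zero _ h.B_ne this.symm

theorem natDegree_B_lt (h : Stage p s c v f S j i ν L N B E R) :
    p ^ j * B.natDegree + 1 ≤ L.natDegree := by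
  have h1 := congrArg natDegree h.deriv_L
  rw [natDegree_pow] at h1
  have h2 : L.natDegree ≠ 0 := by
    intro h0
    have := h.deriv_L
    rw [eq_C_of_natDegree_eq_zero h0, derivative_C] at this
    exact pow_ne_zero _ h.B_ne this.symm
  have := natDegree_derivative_lt h2
  omega

theorem natDegree_f (h : Stage p s c v f S j i ν L N B E R) :
    f.natDegree = v * L.natDegree + p ^ j * N.natDegree := by
  rw [h.f_eq, natDegree_mul (pow_ne_zero _ h.L_ne) (pow_ne_zero _ h.N_ne), natDegree_pow,
    natDegree_pow]

theorem natDegree_L_le (h : Stage p s c v f S j i ν L N B E R) :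
    L.natDegree ≤ f.natDegree := by
  rw [h.natDegree_f]
  have := Nat.le_mul_of_pos_left L.natDegree h.v_pos
  omega

theorem natDegree_f_pos (h : Stage p s c v f S j i ν L N B E R) : 0 < f.natDegree := by
  have := h.natDegree_L_le
  have := h.natDegree_B_lt
  omega

theorem R_ne (h : Stage p s c v f S j i ν L N B E R) : R ≠ 0 := by
  rintro rfl
  exact h.R_zero (by simp)

theorem comp_ne (h : Stage p s c v f S j i ν L N B E R) {g : F[X]} (hg : g ≠ 0) :
    g.comp f ≠ 0 :=
  comp_ne_zero_of_natDegree_pos h.natDegree_f_pos hg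

theorem natDegree_lhs (h : Stage p s c v f S j i ν L N B E R) :
    (L ^ i * N ^ ν * R.comp f).natDegree =
      i * L.natDegree + ν * N.natDegree + R.natDegree * f.natDegree := by
  rw [natDegree_mul (mul_ne_zero (pow_ne_zero _ h.L_ne) (pow_ne_zero _ h.N_ne))
    (h.comp_ne h.R_ne), natDegree_mul (pow_ne_zero _ h.L_ne) (pow_ne_zero _ h.N_ne),
    natDegree_pow, natDegree_pow, natDegree_comp]

theorem good_of_natDegree_eq_zero (h : Stage p s c v f S j i ν L N B E R) (hi : i = 1)
    (hR : R.natDegree = 0) : ∀ n ∈ S.support, ∃ a, v * n + 1 = p ^ a := by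
  obtain ⟨S₀, hS, hS₀⟩ := h.S_eq
  intro n hn
  rw [hS] at hn
  rcases Finset.mem_union.1 (support_add hn) with hn | hn
  · exact hS₀ n hn
  · rw [eq_C_of_natDegree_eq_zero hR, ← C_pow, mul_right_comm, ← C_mul] at hn
    have := Finset.mem_singleton.1 (support_C_mul_X_pow_subset _ _ hn)
    exact ⟨j, by rw [this, h.idx, hi, one_mul]⟩

theorem good_of_eq (h : Stage p s c v f S s i ν L N B E R)
    (hE : E.natDegree ≤ L.natDegree) : ∀ n ∈ S.support, ∃ a, v * n + 1 = p ^ a := by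
  have h1 := h.natDegree_lhs
  have hb := h.natDegree_B_lt
  have hB : B.natDegree ≤ p ^ s * B.natDegree :=
    Nat.le_mul_of_pos_left _ (pow_pos (Fact.out : p.Prime).pos _)
  have h2 : (X ^ p ^ (s - s) * B + E).natDegree ≤ L.natDegree := by
    refine natDegree_add_le_of_degree_le ?_ hE
    refine natDegree_mul_le.trans ?_
    simp
    omega
  rw [← h.eqn, h1] at h2
  have hi := h.i_pos
  have hd := h.natDegree_L_le
  have hi1 : i = 1 := by
    by_contra hne
    have : 2 * L.natDegree ≤ i * L.natDegree := Nat.mul_le_mul_right _ (by omega)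
    omega
  refine h.good_of_natDegree_eq_zero hi1 ?_
  by_contra hne
  have : 1 * f.natDegree ≤ R.natDegree * f.natDegree := Nat.mul_le_mul_right _ (by omega)
  subst hi1
  omega

theorem mul_derivative_f (h : Stage p s c v f S j i ν L N B E R)
    (hN : derivative (N ^ p ^ j) = 0) :
    L * derivative f = C (v : F) * f * derivative L := by
  rw [h.f_eq, derivative_mul, hN, mul_zero, add_zero, ← mul_assoc, mul_derivative_pow]
  ring

theorem mul_derivative_lhs (h : Stage p s c v f S j i ν L N B E R)
    (hN : derivative (N ^ p ^ j) = 0) :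
    N * L * derivative (L ^ i * N ^ ν * R.comp f) =
      L ^ i * N ^ (ν + 1) * derivative L * (weightedEuler i v R).comp f +
        C (ν : F) * derivative N * L * (L ^ i * N ^ ν * R.comp f) := by
  have e1 := mul_derivative_pow L i
  have e2 := mul_derivative_pow N ν
  have e3 := h.mul_derivative_f hN
  simp only [derivative_mul, derivative_comp, weightedEuler, add_comp, mul_comp, C_comp, X_comp]
  linear_combination (N * N ^ ν * R.comp f) * e1 + (L * L ^ i * R.comp f) * e2 +
    (N * L ^ i * N ^ ν * (derivative R).comp f) * e3

theorem natCast_mul_add_one (h : Stage p s c v f S j i ν L N B E R) (hj : j ≠ 0) :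
    (v : F) * ν + 1 = 0 := by
  have := congrArg (Nat.cast : ℕ → F) h.idx
  push_cast at this
  rw [this]
  simp [hj]

/-- The differential identity obtained by eliminating `X ^ p ^ (s - j)`. -/
theorem key_identity {i₀ ν₀ : ℕ} (h : Stage p s c v f S j (i₀ + 1) (ν₀ + 1) L N B E R)
    (hj : j ≠ 0) (hjs : j < s) :
    (C (v : F) * (N * derivative B) + derivative N * B) * (L ^ (i₀ + 1) * N ^ ν₀) * R.comp f +
        C (v : F) * (derivative E * B - E * derivative B) =
      C (v : F) * B ^ (p ^ j + 1) * (L ^ i₀ * N ^ (ν₀ + 1)) *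
        (weightedEuler (i₀ + 1) v R).comp f := by
  have hN := derivative_pow_char_pow (p := p) N hj
  have h1 := h.mul_derivative_lhs hN
  have h2 : derivative (L ^ (i₀ + 1) * N ^ (ν₀ + 1) * R.comp f) =
      X ^ p ^ (s - j) * derivative B + derivative E := by
    rw [h.eqn, derivative_add, derivative_mul,
      derivative_pow_char_pow (p := p) X (Nat.sub_ne_zero_of_lt hjs), zero_mul, zero_add]
  have h3 := h.eqn
  have h4 : C (v : F) * C ((ν₀ + 1 : ℕ) : F) + 1 = 0 := by
    rw [← C_mul, ← C_1, ← C_add, h.natCast_mul_add_one hj, C_0]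
  rw [h.deriv_L] at h1
  refine mul_left_cancel₀ (mul_ne_zero h.N_ne h.L_ne) ?_
  set Φ := L ^ (i₀ + 1) * N ^ (ν₀ + 1) * R.comp f with hΦ
  have h5 : (C (v : F) * (N * derivative B) + derivative N * B) * L * Φ +
      N * L * (C (v : F) * (derivative E * B - E * derivative B)) =
      C (v : F) * B ^ (p ^ j + 1) * (L ^ (i₀ + 1) * N ^ (ν₀ + 1 + 1)) *
        (weightedEuler (i₀ + 1) v R).comp f := by
    linear_combination (C (v : F) * B) * h1 - (C (v : F) * B * N * L) * h2 +
      (C (v : F) * N * L * derivative B) * h3 + (derivative N * B * L * Φ) * h4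
  rw [hΦ] at h5
  linear_combination h5

theorem succ_of_pow [Finite F] {N₁ B₁ E₁ : F[X]}
    (h : Stage p s c v f S j i ν L (N₁ ^ p) (B₁ ^ p) (E₁ ^ p) R) (hjs : j < s) :
    ∃ (i' : ℕ) (R' : F[X]), Stage p s c v f S (j + 1) i' ν L N₁ B₁ E₁ R' := by
  have hp : p ≠ 0 := (Fact.out : p.Prime).ne_zero
  have hX : (X : F[X]) ^ p ^ (s - j) = (X ^ p ^ (s - (j + 1))) ^ p := by
    rw [← pow_mul, ← pow_succ]; congr 2; omega
  have hN : derivative ((N₁ ^ p) ^ p ^ j) = 0 := by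
    rw [← pow_mul, ← pow_succ']; exact derivative_pow_char_pow _ (Nat.succ_ne_zero j)
  have hΦ : L ^ i * (N₁ ^ p) ^ ν * R.comp f = (X ^ p ^ (s - (j + 1)) * B₁ + E₁) ^ p := by
    rw [h.eqn, hX, ← mul_pow, add_pow_char]
  have h1 := h.mul_derivative_lhs hN
  rw [hΦ, derivative_pow_char, derivative_pow_char, mul_zero, mul_zero, zero_mul, zero_mul,
    add_zero, h.deriv_L] at h1
  have h2 : weightedEuler i v R = 0 := by
    by_contra hne
    exact mul_ne_zero (mul_ne_zero (mul_ne_zero (pow_ne_zero _ h.L_ne) (pow_ne_zero _ h.N_ne))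
      (pow_ne_zero _ h.B_ne)) (h.comp_ne hne) h1.symm
  obtain ⟨⟨i', rfl⟩, R', rfl⟩ := dvd_and_exists_pow_of_weightedEuler_eq_zero h.v_ne h.R_zero h2
  refine ⟨i', R', ?_⟩
  obtain ⟨S₀, hS, hS₀⟩ := h.S_eq
  refine ⟨?_, ?_, ?_, ?_, h.v_ne, ⟨S₀, ?_, hS₀⟩, ?_, ?_, ?_⟩
  · rw [h.f_eq, ← pow_mul, ← pow_succ']
  · rw [h.deriv_L, ← pow_mul, ← pow_succ']
  · exact fun h0 => h.B_ne (by rw [h0, zero_pow hp])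
  · exact fun h0 => h.N_ne (by rw [h0, zero_pow hp])
  · rw [hS, ← pow_mul, ← pow_succ']
  · intro h0
    apply h.R_zero
    rw [coeff_zero_eq_eval_zero] at h0 ⊢
    rw [eval_pow, h0, zero_pow hp]
  · rw [h.idx]; ring
  · refine eq_of_pow_char_pow_eq (p := p) (k := 1) ?_
    rw [pow_one, ← hΦ, pow_comp]
    ring

theorem succ_of_const [Finite F] {N₁ B₁ : F[X]} {r : F}
    (h : Stage p s c v f S j 1 ν L (N₁ ^ p) (B₁ ^ p) E R) (hjs : j < s)
    (hR : R.natDegree ≠ 0) (hr : weightedEuler 1 v R = C r) :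
    ∃ (i' ν' : ℕ) (E' R' : F[X]), Stage p s c v f S (j + 1) i' ν' L N₁ B₁ E' R' ∧
      E' ^ p = E - C r * (L * (N₁ ^ p) ^ ν) := by
  have hp : p ≠ 0 := (Fact.out : p.Prime).ne_zero
  have hr0 : R.coeff 0 = r := by
    have := weightedEuler_coeff_zero 1 v R
    rw [hr] at this
    simpa using this.symm
  have hne : R - C r ≠ 0 := fun h0 => hR (by rw [sub_eq_zero.1 h0, natDegree_C])
  obtain ⟨m, K, hK, hK0⟩ := exists_eq_X_pow_mul hne
  have hRK : R = C r + X ^ m * K := by rw [← hK]; ring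
  have hEu : weightedEuler (1 + v * m) v K = 0 := by
    have h1 := hr
    have e1 := mul_derivative_pow (X : F[X]) m
    rw [hRK] at h1
    simp only [weightedEuler, derivative_add, derivative_C, derivative_mul, zero_add] at h1 ⊢
    refine mul_left_cancel₀ (pow_ne_zero m (X_ne_zero (R := F))) ?_
    rw [derivative_X, mul_one] at e1
    push_cast at h1 ⊢
    rw [C_add, C_mul]
    rw [C_1] at h1 ⊢
    linear_combination h1 - (C (v : F) * K) * e1
  obtain ⟨⟨i', hi'⟩, K', rfl⟩ := dvd_and_exists_pow_of_weightedEuler_eq_zero h.v_ne hK0 hEu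
  have hX : (X : F[X]) ^ p ^ (s - j) = (X ^ p ^ (s - (j + 1))) ^ p := by
    rw [← pow_mul, ← pow_succ]; congr 2; omega
  have hLN : L * (N₁ ^ p) ^ ν * (f ^ m * K'.comp f ^ p) =
      (L ^ i' * N₁ ^ (ν + m * p ^ j) * K'.comp f) ^ p := by
    have : L * L ^ (v * m) = (L ^ i') ^ p := by
      rw [← pow_mul, mul_comm i' p, ← hi', pow_add, pow_one]
    calc L * (N₁ ^ p) ^ ν * (f ^ m * K'.comp f ^ p)
        = (L * L ^ (v * m)) * (N₁ ^ p) ^ (ν + m * p ^ j) * K'.comp f ^ p := by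
          rw [show f ^ m = L ^ (v * m) * (N₁ ^ p) ^ (m * p ^ j) by
            rw [h.f_eq, mul_pow, ← pow_mul, ← pow_mul, mul_comm m (p ^ j)]]
          ring
      _ = _ := by rw [this]; ring
  have hEp : (L ^ i' * N₁ ^ (ν + m * p ^ j) * K'.comp f - X ^ p ^ (s - (j + 1)) * B₁) ^ p =
      E - C r * (L * (N₁ ^ p) ^ ν) := by
    have h1 := h.eqn
    rw [hRK, add_comp, C_comp, mul_comp, pow_comp, X_comp, pow_comp, pow_one] at h1
    rw [sub_pow_char, ← hLN, mul_pow, ← hX]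
    linear_combination h1
  refine ⟨i', ν + m * p ^ j, _, K', ?_, hEp⟩
  obtain ⟨S₀, hS, hS₀⟩ := h.S_eq
  refine ⟨?_, ?_, ?_, ?_, h.v_ne, ⟨S₀ + C (c * r ^ p ^ j) * X ^ ν, ?_, ?_⟩, ?_, ?_, by ring⟩
  · rw [h.f_eq, ← pow_mul, ← pow_succ']
  · rw [h.deriv_L, ← pow_mul, ← pow_succ']
  · exact fun h0 => h.B_ne (by rw [h0, zero_pow hp])
  · exact fun h0 => h.N_ne (by rw [h0, zero_pow hp])
  · rw [hS, hRK, add_pow_char_pow, C_mul, C_pow]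
    ring
  · intro n hn
    rcases Finset.mem_union.1 (support_add hn) with hn | hn
    · exact hS₀ n hn
    · have := Finset.mem_singleton.1 (support_C_mul_X_pow_subset _ _ hn)
      exact ⟨j, by rw [this, h.idx, one_mul]⟩
  · intro h0
    apply hK0
    rw [coeff_zero_eq_eval_zero] at h0 ⊢
    rw [eval_pow, h0, zero_pow hp]
  · have h1 := h.idx
    calc v * (ν + m * p ^ j) + 1 = (v * ν + 1) + v * m * p ^ j := by ring
      _ = (1 + v * m) * p ^ j := by rw [h1]; ring
      _ = i' * p ^ (j + 1) := by rw [hi']; ring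

theorem derivative_eq_zero_of_isCoprime (h : Stage p s c v f S j i ν L N B E R)
    (hNB : IsCoprime N B)
    (hU : C (v : F) * (N * derivative B) + derivative N * B = 0) :
    derivative B = 0 ∧ derivative N = 0 := by
  have hv : (C (v : F)) ≠ 0 := C_ne_zero.2 h.v_ne
  have hB : derivative B = 0 := by
    have h1 : B ∣ C (v : F) * (N * derivative B) :=
      ⟨-derivative N, by linear_combination hU⟩
    rw [← mul_assoc] at h1
    have h2 : IsCoprime B (C (v : F) * N) :=
      IsCoprime.mul_right (isCoprime_C h.v_ne B) hNB.symm
    have h3 := h2.dvd_of_dvd_mul_left h1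
    by_contra hne
    have h4 : B.natDegree ≠ 0 := fun h0 => hne (by rw [eq_C_of_natDegree_eq_zero h0, derivative_C])
    have := natDegree_le_of_dvd h3 hne
    have := natDegree_derivative_lt h4
    omega
  refine ⟨hB, ?_⟩
  rw [hB, mul_zero, mul_zero, zero_add] at hU
  exact (mul_eq_zero.1 hU).resolve_right h.B_ne

theorem ν_pos (h : Stage p s c v f S j i ν L N B E R) (hj : j ≠ 0) : ν ≠ 0 := by
  rintro rfl
  have h1 := h.idx
  rw [mul_zero, zero_add] at h1
  have h2 : p ^ j ∣ 1 := ⟨i, by rw [h1, mul_comm]⟩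
  have := (dvd_pow_self p hj).trans h2
  exact (Fact.out : p.Prime).one_lt.ne' (Nat.dvd_one.1 this)

theorem natDegree_main_eq {U : F[X]} {i₀ ν₀ : ℕ}
    (h : Stage p s c v f S j (i₀ + 1) (ν₀ + 1) L N B E R) (hU : U ≠ 0) :
    (U * (L ^ (i₀ + 1) * N ^ ν₀) * R.comp f).natDegree =
      U.natDegree + ((i₀ + 1) * L.natDegree + ν₀ * N.natDegree) + R.natDegree * f.natDegree := by
  have h1 := pow_ne_zero (i₀ + 1) h.L_ne
  have h2 := pow_ne_zero ν₀ h.N_ne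
  rw [natDegree_mul (mul_ne_zero hU (mul_ne_zero h1 h2)) (h.comp_ne h.R_ne),
    natDegree_mul hU (mul_ne_zero h1 h2), natDegree_mul h1 h2, natDegree_pow, natDegree_pow,
    natDegree_comp]

theorem natDegree_rhs_le (P i₀ ν₀ : ℕ) (a : F) (L N B f H : F[X]) :
    (C a * B ^ (P + 1) * (L ^ i₀ * N ^ ν₀) * H.comp f).natDegree ≤
      (P + 1) * B.natDegree + (i₀ * L.natDegree + ν₀ * N.natDegree) +
        H.natDegree * f.natDegree := by
  refine natDegree_mul_le.trans (Nat.add_le_add ?_ natDegree_comp.le)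
  refine natDegree_mul_le.trans (Nat.add_le_add ?_ ?_)
  · exact (natDegree_C_mul_le _ _).trans natDegree_pow_le
  · exact natDegree_mul_le.trans (Nat.add_le_add natDegree_pow_le natDegree_pow_le)

theorem natDegree_wronskian_le (E B : F[X]) :
    (derivative E * B - E * derivative B).natDegree ≤ E.natDegree + B.natDegree := by
  have h1 := natDegree_derivative_le E
  have h2 := natDegree_derivative_le B
  refine (natDegree_sub_le_of_le natDegree_mul_le natDegree_mul_le).trans (max_le ?_ ?_) <;> omega

/-- The descent terminates once `N` and `B` are small compared with `L`. -/
theorem good_of_small [Finite F] (t : ℕ) : ∀ {j i ν : ℕ} {N B E R : F[X]},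
    Stage p s c v f S j i ν L N B E R → j ≠ 0 → j + t = s → IsCoprime N B →
    p ^ j * N.natDegree + 2 * (p ^ j * B.natDegree) < L.natDegree →
    E.natDegree ≤ L.natDegree → ∀ n ∈ S.support, ∃ a, v * n + 1 = p ^ a := by
  have hp2 : 2 ≤ p := (Fact.out : p.Prime).two_le
  induction t with
  | zero =>
    intro j i ν N B E R h hj hjs _ _ hE
    obtain rfl : j = s := by omega
    exact h.good_of_eq hE
  | succ t ih =>
    intro j i ν N B E R h hj hjs hNB hsmall hE
    obtain ⟨i₀, rfl⟩ := Nat.exists_eq_succ_of_ne_zero h.i_pos.ne'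
    obtain ⟨ν₀, rfl⟩ := Nat.exists_eq_succ_of_ne_zero (h.ν_pos hj)
    by_cases hfin : i₀ = 0 ∧ R.natDegree = 0
    · exact h.good_of_natDegree_eq_zero (by rw [hfin.1]) hfin.2
    have hkey := h.key_identity hj (by omega)
    have hd := h.natDegree_L_le
    have hPB : B.natDegree ≤ p ^ j * B.natDegree :=
      Nat.le_mul_of_pos_left _ (pow_pos (by omega) _)
    have hPN : N.natDegree ≤ p ^ j * N.natDegree :=
      Nat.le_mul_of_pos_left _ (pow_pos (by omega) _)
    have hbig : 2 * L.natDegree ≤ (i₀ + 1) * L.natDegree + R.natDegree * f.natDegree := by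
      rcases Nat.eq_zero_or_pos i₀ with h0 | h0
      · have : R.natDegree ≠ 0 := fun h1 => hfin ⟨h0, h1⟩
        have := Nat.le_mul_of_pos_left f.natDegree (Nat.pos_of_ne_zero this)
        rw [h0]; omega
      · have : 2 * L.natDegree ≤ (i₀ + 1) * L.natDegree := Nat.mul_le_mul_right _ (by omega)
        omega
    have hW := natDegree_wronskian_le E B
    have hU : C (v : F) * (N * derivative B) + derivative N * B = 0 := by
      by_contra hU
      have h1 := h.natDegree_main_eq hU
      rw [eq_sub_of_add_eq hkey] at h1
      have h2 := natDegree_sub_le_of_le (natDegree_rhs_le (p ^ j) i₀ (ν₀ + 1) (v : F) L N B f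
        (weightedEuler (i₀ + 1) v R)) (natDegree_C_mul_le (v : F) _ |>.trans hW)
      rw [h1] at h2
      have h3 := Nat.mul_le_mul_right f.natDegree (natDegree_weightedEuler_le (i₀ + 1) v R)
      rcases le_max_iff.1 h2 with h2 | h2
      · simp only [add_mul, one_mul] at h2 hbig h3
        omega
      · omega
    obtain ⟨hB', hN'⟩ := h.derivative_eq_zero_of_isCoprime hNB hU
    rw [hU, zero_mul, zero_mul, zero_add, hB', mul_zero, sub_zero] at hkey
    have hv : (C (v : F)) ≠ 0 := C_ne_zero.2 h.v_ne
    have hE' : derivative E = B ^ p ^ j * (L ^ i₀ * N ^ (ν₀ + 1)) *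
        (weightedEuler (i₀ + 1) v R).comp f := by
      refine mul_left_cancel₀ (mul_ne_zero hv h.B_ne) ?_
      linear_combination hkey
    obtain ⟨B₁, rfl⟩ := exists_pow_char_eq_of_derivative_eq_zero (p := p) hB'
    obtain ⟨N₁, rfl⟩ := exists_pow_char_eq_of_derivative_eq_zero (p := p) hN'
    have hNB₁ : IsCoprime N₁ B₁ := (IsCoprime.pow_iff (by omega) (by omega)).1 hNB
    have hsmall₁ : p ^ (j + 1) * N₁.natDegree + 2 * (p ^ (j + 1) * B₁.natDegree) <
        L.natDegree := by
      rw [natDegree_pow, natDegree_pow] at hsmall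
      rwa [pow_succ, mul_assoc, mul_assoc]
    by_cases hH : weightedEuler (i₀ + 1) v R = 0
    · rw [hH, zero_comp, mul_zero] at hE'
      obtain ⟨E₁, rfl⟩ := exists_pow_char_eq_of_derivative_eq_zero (p := p) hE'
      obtain ⟨i', R', h'⟩ := h.succ_of_pow (by omega)
      refine ih h' (by omega) (by omega) hNB₁ hsmall₁ ?_
      rw [natDegree_pow] at hE
      have := Nat.le_mul_of_pos_left E₁.natDegree (show 0 < p by omega)
      omega
    · have hdeg := congrArg natDegree hE'
      have hl : 0 < L.natDegree := by omega
      rw [natDegree_mul (mul_ne_zero (pow_ne_zero _ h.B_ne)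
        (mul_ne_zero (pow_ne_zero _ h.L_ne) (pow_ne_zero _ h.N_ne))) (h.comp_ne hH),
        natDegree_mul (pow_ne_zero _ h.B_ne)
        (mul_ne_zero (pow_ne_zero _ h.L_ne) (pow_ne_zero _ h.N_ne)),
        natDegree_mul (pow_ne_zero _ h.L_ne) (pow_ne_zero _ h.N_ne), natDegree_pow L,
        natDegree_comp] at hdeg
      have hElt : (derivative E).natDegree < L.natDegree := by
        have := natDegree_derivative_le E
        omega
      have hi0 : i₀ = 0 := by
        by_contra hne
        have := Nat.le_mul_of_pos_left L.natDegree (Nat.pos_of_ne_zero hne)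
        omega
      have hH0 : (weightedEuler (i₀ + 1) v R).natDegree = 0 := by
        by_contra hne
        have := Nat.le_mul_of_pos_left f.natDegree (Nat.pos_of_ne_zero hne)
        omega
      subst hi0
      obtain ⟨i', ν', E₁, R', h', hE₁⟩ := h.succ_of_const (by omega) (fun h0 => hfin ⟨rfl, h0⟩)
        (eq_C_of_natDegree_eq_zero hH0)
      refine ih h' (by omega) (by omega) hNB₁ hsmall₁ ?_
      have h2 := congrArg natDegree hE₁
      rw [natDegree_pow] at h2
      have h3 : (E - C ((weightedEuler (0 + 1) v R).coeff 0) *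
          (L * (N₁ ^ p) ^ (ν₀ + 1))).natDegree ≤ 2 * L.natDegree := by
        refine (natDegree_sub_le_of_le hE ((natDegree_C_mul_le _ _).trans
          (natDegree_mul_le.trans (Nat.add_le_add_left natDegree_pow_le _)))).trans ?_
        have h4 : ν₀ + 1 ≤ p ^ j := by
          have h5 := h.idx
          have h6 := Nat.le_mul_of_pos_left (ν₀ + 1) h.v_pos
          simp only [Nat.succ_eq_add_one, zero_add, one_mul] at h5
          omega
        have := Nat.mul_le_mul_right (N₁ ^ p).natDegree h4
        refine max_le ?_ ?_ <;> omega
      rw [← h2] at h3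
      have := Nat.mul_le_mul_right E₁.natDegree hp2
      omega

end Stage

theorem isCoprime_X {g : F[X]} (hg : g.coeff 0 ≠ 0) : IsCoprime g X := by
  refine IsCoprime.symm ((Irreducible.coprime_iff_not_dvd irreducible_X).2 fun h => hg ?_)
  exact X_dvd_iff.1 h

theorem derivative_eq_zero_of_dvd {g : F[X]} (h : g ∣ derivative g) : derivative g = 0 := by
  by_contra hne
  have h4 : g.natDegree ≠ 0 := fun h0 => hne (by rw [eq_C_of_natDegree_eq_zero h0, derivative_C])
  have := natDegree_le_of_dvd h hne
  have := natDegree_derivative_lt h4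
  omega

theorem derivative_eq_zero_of_wronskian {g h : F[X]} (hgh : IsCoprime g h) (hg : g ≠ 0)
    (hW : derivative h * g = h * derivative g) : derivative g = 0 ∧ derivative h = 0 := by
  have h1 : derivative g = 0 :=
    derivative_eq_zero_of_dvd (hgh.dvd_of_dvd_mul_left ⟨derivative h, by rw [← hW, mul_comm]⟩)
  rw [h1, mul_zero] at hW
  exact ⟨h1, (mul_eq_zero.1 hW).resolve_right hg⟩

theorem exists_eq_gcd_mul {g h : F[X]} (hg : g ≠ 0) :
    ∃ D g₁ h₁ : F[X], D ≠ 0 ∧ g = D * g₁ ∧ h = D * h₁ ∧ IsCoprime g₁ h₁ := by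
  classical
  obtain ⟨g₁, hg₁⟩ := EuclideanDomain.gcd_dvd_left g h
  obtain ⟨h₁, hh₁⟩ := EuclideanDomain.gcd_dvd_right g h
  have hD : EuclideanDomain.gcd g h ≠ 0 := fun h0 => hg (EuclideanDomain.gcd_eq_zero_iff.1 h0).1
  refine ⟨_, g₁, h₁, hD, hg₁, hh₁, ?_⟩
  have := EuclideanDomain.gcd_eq_gcd_ab g h
  refine ⟨EuclideanDomain.gcdA g h, EuclideanDomain.gcdB g h, mul_left_cancel₀ hD ?_⟩
  generalize EuclideanDomain.gcd g h = D at *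
  generalize EuclideanDomain.gcdA g h = x at *
  generalize EuclideanDomain.gcdB g h = y at *
  linear_combination -this - x * hg₁ - y * hh₁

theorem isCoprime_comp {g h : F[X]} (f : F[X]) (hgh : IsCoprime g h) :
    IsCoprime (g.comp f) (h.comp f) := by
  obtain ⟨x, y, hxy⟩ := hgh
  exact ⟨x.comp f, y.comp f, by rw [← mul_comp, ← mul_comp, ← add_comp, hxy, one_comp]⟩

theorem eq_pow_mul_pow_of_mul_derivative [Finite F] {D L : F[X]} {a : ℕ} (hL : Squarefree L)
    (h : C (a : F) * (D * derivative L) = derivative D * L) :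
    ∃ N : F[X], D = L ^ (a % p) * N ^ p := by
  have hp := (Fact.out : p.Prime)
  have ha : a % p < p := Nat.mod_lt _ hp.pos
  have h1 : derivative (D * L ^ (p - a % p)) = 0 := by
    refine (mul_eq_zero.1 (?_ : L * _ = 0)).resolve_left hL.ne_zero
    have h2 := mul_derivative_pow L (p - a % p)
    have h3 : C (a : F) + C ((p - a % p : ℕ) : F) = 0 := by
      rw [← C_add, ← Nat.cast_add, (CharP.cast_eq_zero_iff F p _).2, C_0]
      have := Nat.div_add_mod a p
      exact ⟨a / p + 1, by rw [mul_add]; omega⟩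
    rw [derivative_mul]
    linear_combination D * h2 - L ^ (p - a % p) * h + (D * derivative L * L ^ (p - a % p)) * h3
  obtain ⟨W, hW⟩ := exists_pow_char_eq_of_derivative_eq_zero (p := p) h1
  have h4 : L ∣ W := by
    rw [← hL.dvd_pow_iff_dvd hp.ne_zero, hW]
    exact (dvd_pow_self L (by omega)).mul_left D
  obtain ⟨N, rfl⟩ := h4
  refine ⟨N, mul_right_cancel₀ (pow_ne_zero (p - a % p) hL.ne_zero) ?_⟩
  rw [← hW, mul_pow]
  nth_rewrite 1 [show p = a % p + (p - a % p) by omega]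
  rw [pow_add]
  ring

theorem exists_eq_pow_mul_pow [Finite F] {D L K f : F[X]} {a b : ℕ} (hL : Squarefree L)
    (hL' : derivative L ≠ 0) (hD : D ≠ 0) (hdeg : (D * derivative L).natDegree < f.natDegree)
    (hb : (b : F) ≠ 0) (hK : K.coeff 0 ≠ 0)
    (h : D * derivative L * (weightedEuler a b K).comp f = derivative D * L * K.comp f) :
    ∃ (m : ℕ) (N : F[X]), D = L ^ m * N ^ p := by
  have hf : 0 < f.natDegree := by omega
  have hK0 : K ≠ 0 := by rintro rfl; simp at hK
  have hK' : derivative K = 0 := by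
    obtain ⟨g, K₁, K₂, hg, h1, h2, hco⟩ := exists_eq_gcd_mul (h := derivative K) hK0
    have h3 : weightedEuler a b K = g * (C (a : F) * K₁ + C (b : F) * (X * K₂)) := by
      rw [weightedEuler, h2]
      nth_rewrite 1 [h1]
      ring
    rw [h3, mul_comp] at h
    nth_rewrite 1 [h1] at h
    rw [mul_comp] at h
    have h4 : K₁.coeff 0 ≠ 0 := by
      intro h0
      rw [h1, mul_coeff_zero, h0, mul_zero] at hK
      exact hK rfl
    have h5 : IsCoprime K₁ (C (a : F) * K₁ + C (b : F) * (X * K₂)) := by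
      obtain ⟨x, y, hxy⟩ :=
        IsCoprime.mul_right (isCoprime_C hb _) (IsCoprime.mul_right (isCoprime_X h4) hco)
      exact ⟨x - y * C (a : F), y, by linear_combination hxy⟩
    have h6 : K₁.comp f ∣ D * derivative L := by
      refine (isCoprime_comp f h5).dvd_of_dvd_mul_right ⟨derivative D * L, ?_⟩
      refine mul_left_cancel₀ (comp_ne_zero_of_natDegree_pos hf hg) ?_
      linear_combination h
    have h7 := natDegree_le_of_dvd h6 (mul_ne_zero hD hL')
    rw [natDegree_comp] at h7
    have h8 : K₁.natDegree = 0 := by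
      by_contra hne
      have := Nat.le_mul_of_pos_left f.natDegree (Nat.pos_of_ne_zero hne)
      omega
    by_contra hne
    refine hne (derivative_eq_zero_of_dvd ?_)
    rw [h2]
    nth_rewrite 1 [h1]
    refine mul_dvd_mul_left g ?_
    rw [eq_C_of_natDegree_eq_zero h8] at h4 ⊢
    rw [coeff_C_zero] at h4
    exact (isUnit_C.2 h4.isUnit).dvd
  refine ⟨a % p, eq_pow_mul_pow_of_mul_derivative hL ?_⟩
  refine mul_right_cancel₀ (comp_ne_zero_of_natDegree_pos hf hK0) ?_
  rw [weightedEuler, hK', mul_zero, mul_zero, add_zero, mul_comp, C_comp] at h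
  linear_combination h

theorem eq_C_mul_of_comp_eq {a b δ f P Q : F[X]} (hP : P.natDegree ≠ 0)
    (h : a * P.comp f = b * Q.comp f + δ) (hb : b.natDegree < f.natDegree)
    (hδ : δ.natDegree < f.natDegree) : ∃ e : F, δ = C e * b := by
  have hP0 : P ≠ 0 := fun h0 => hP (by rw [h0, natDegree_zero])
  have hr : (Q % P).natDegree < P.natDegree := natDegree_mod_lt Q hP
  have h1 : (a - b * (Q / P).comp f) * P.comp f = b * (Q % P).comp f + δ := by
    have h2 := congrArg (fun g => g.comp f) (EuclideanDomain.div_add_mod Q P)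
    simp only [add_comp, mul_comp] at h2
    linear_combination h - b * h2
  have h3 : b * (Q % P).comp f + δ = 0 := by
    by_contra hne
    have h4 := natDegree_le_of_dvd (Dvd.intro_left _ h1) hne
    have h5 : (b * (Q % P).comp f + δ).natDegree < P.natDegree * f.natDegree := by
      obtain ⟨e, he⟩ := Nat.exists_eq_succ_of_ne_zero hP
      have h6 : (Q % P).natDegree * f.natDegree ≤ e * f.natDegree :=
        Nat.mul_le_mul_right _ (by omega)
      rw [he, Nat.succ_mul]
      have h7 : (b * (Q % P).comp f).natDegree ≤ b.natDegree + (Q % P).natDegree * f.natDegree :=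
        natDegree_mul_le.trans (by rw [natDegree_comp])
      have h8 := natDegree_add_le (b * (Q % P).comp f) δ
      rcases le_max_iff.1 h8 with h8 | h8 <;> omega
    rw [natDegree_comp] at h4
    omega
  rcases eq_or_ne b 0 with rfl | hb0
  · exact ⟨0, by simpa using h3⟩
  have h9 : (Q % P).natDegree = 0 := by
    by_contra hne
    have hne0 : Q % P ≠ 0 := fun h0 => hne (by rw [h0, natDegree_zero])
    have h10 := natDegree_mul hb0 (comp_ne_zero_of_natDegree_pos (f := f) (by omega) hne0)
    rw [eq_neg_of_add_eq_zero_left h3, natDegree_neg, natDegree_comp] at h10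
    have := Nat.le_mul_of_pos_left f.natDegree (Nat.pos_of_ne_zero hne)
    omega
  refine ⟨-(Q % P).coeff 0, ?_⟩
  rw [eq_C_of_natDegree_eq_zero h9, C_comp] at h3
  rw [C_neg]
  linear_combination h3

theorem derivative_X_mul_pow_sub_pow (B G : F[X]) {k : ℕ} (hk : k ≠ 0) :
    derivative (X * B ^ p ^ k - G ^ p ^ k) = B ^ p ^ k := by
  rw [derivative_sub, derivative_mul, derivative_pow_char_pow B hk, derivative_pow_char_pow G hk]
  simp

theorem squarefree_X_mul_pow_sub_pow {B G : F[X]} (hBG : IsCoprime B G) {k : ℕ} (hk : k ≠ 0) :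
    Squarefree (X * B ^ p ^ k - G ^ p ^ k) := by
  refine Separable.squarefree ?_
  rw [Separable, derivative_X_mul_pow_sub_pow B G hk]
  obtain ⟨x, y, hxy⟩ := hBG.pow (m := p ^ k) (n := p ^ k)
  exact ⟨-y, x + y * X, by linear_combination hxy⟩

theorem natDegree_G_le {B G : F[X]} {k : ℕ} (hk : k ≠ 0) (hB : B ≠ 0) :
    p ^ k * G.natDegree ≤ (X * B ^ p ^ k - G ^ p ^ k).natDegree := by
  set L := X * B ^ p ^ k - G ^ p ^ k with hL
  have h1 := derivative_X_mul_pow_sub_pow (p := p) B G hk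
  rw [← hL] at h1
  have h2 : L.natDegree ≠ 0 := by
    intro h0
    rw [eq_C_of_natDegree_eq_zero h0, derivative_C] at h1
    exact pow_ne_zero _ hB h1.symm
  have h3 := natDegree_derivative_lt h2
  rw [h1] at h3
  have h4 : G ^ p ^ k = X * B ^ p ^ k - L := by rw [hL]; ring
  rw [← natDegree_pow, h4]
  refine (natDegree_sub_le_of_le (natDegree_mul_le.trans ?_) le_rfl).trans (max_self _).le
  rw [natDegree_X]; omega

/-- A factorization of `f - γ`, for a root `γ` of `T`, into a power of a squarefree polynomial
of a special form and a `p ^ k`-th power. -/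
structure Presentation (p : ℕ) (T f : F[X]) (k : ℕ) (γ : F) (v : ℕ) (L N B G : F[X]) : Prop where
  root : T.eval γ = 0
  f_eq : f - C γ = L ^ v * N ^ p ^ k
  L_eq : L = X * B ^ p ^ k - G ^ p ^ k
  coprime : IsCoprime B G
  v_ne : (v : F) ≠ 0

namespace Stage

variable {s : ℕ} {c : F} {v : ℕ} {f S : F[X]} {j i ν : ℕ} {L N B E R : F[X]}

theorem iterate_succ_of_pow [Finite F] (t : ℕ) : ∀ {j i : ℕ} {R : F[X]},
    Stage p s c v f S j i ν L (N ^ p ^ t) (B ^ p ^ t) (E ^ p ^ t) R → j + t ≤ s →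
    ∃ (i' : ℕ) (R' : F[X]), Stage p s c v f S (j + t) i' ν L N B E R' := by
  induction t with
  | zero =>
    intro j i R h _
    simp only [pow_zero, pow_one] at h
    exact ⟨i, R, h⟩
  | succ t ih =>
    intro j i R h hjs
    simp only [pow_succ p t, pow_mul] at h
    obtain ⟨i', R', h'⟩ := h.succ_of_pow (by omega)
    obtain ⟨i'', R'', h''⟩ := ih h' (by omega)
    exact ⟨i'', R'', by rwa [show j + (t + 1) = j + 1 + t by omega]⟩

/-- If the Euler derivative of `R` is constant, the descent terminates. -/
theorem good_of_const [Finite F] (h : Stage p s c v f S j 1 ν L N B E R) (hj : j ≠ 0)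
    (hjs : j < s) (hNB : IsCoprime N B) (hE : p ^ j * E.natDegree ≤ L.natDegree)
    (hR : R.natDegree ≠ 0) (hH : (weightedEuler 1 v R).natDegree = 0) :
    ∀ n ∈ S.support, ∃ a, v * n + 1 = p ^ a := by
  have hp2 : 2 ≤ p := (Fact.out : p.Prime).two_le
  have hP2 : 2 ≤ p ^ j := hp2.trans (Nat.le_self_pow hj p)
  obtain ⟨ν₀, rfl⟩ : ∃ ν₀, ν = ν₀ + 1 := Nat.exists_eq_succ_of_ne_zero (h.ν_pos hj)
  have hkey := h.key_identity (i₀ := 0) hj hjs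
  rw [zero_add] at hkey
  have hd := h.natDegree_f
  have hb := h.natDegree_B_lt
  have hvL := Nat.le_mul_of_pos_left L.natDegree h.v_pos
  have hRf := Nat.le_mul_of_pos_left f.natDegree (Nat.pos_of_ne_zero hR)
  have hPB : 2 * B.natDegree ≤ p ^ j * B.natDegree := Nat.mul_le_mul_right _ hP2
  have hPN : 2 * N.natDegree ≤ p ^ j * N.natDegree := Nat.mul_le_mul_right _ hP2
  have hPE : 2 * E.natDegree ≤ p ^ j * E.natDegree := Nat.mul_le_mul_right _ hP2
  have hW := natDegree_wronskian_le E B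
  set H := weightedEuler 1 v R with hHdef
  have hU : C (v : F) * (N * derivative B) + derivative N * B = 0 := by
    by_contra hU
    have h1 := h.natDegree_main_eq (i₀ := 0) hU
    rw [zero_add, eq_sub_of_add_eq hkey] at h1
    have h2 := natDegree_sub_le_of_le (natDegree_rhs_le (p ^ j) 0 (ν₀ + 1) (v : F) L N B f H)
      (natDegree_C_mul_le (v : F) _ |>.trans hW)
    rw [h1, hH] at h2
    rcases le_max_iff.1 h2 with h2 | h2
    · simp only [add_mul, one_mul, zero_mul] at h2
      omega
    · omega
  obtain ⟨hB', hN'⟩ := h.derivative_eq_zero_of_isCoprime hNB hU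
  have hv : (C (v : F)) ≠ 0 := C_ne_zero.2 h.v_ne
  have hH0 : H ≠ 0 := by
    intro h0
    have h1 := weightedEuler_coeff_zero 1 v R
    rw [← hHdef, h0, coeff_zero, Nat.cast_one, one_mul] at h1
    exact h.R_zero h1.symm
  have hE' : derivative E = B ^ p ^ j * N ^ (ν₀ + 1) * H.comp f := by
    rw [hU, hB'] at hkey
    refine mul_left_cancel₀ (mul_ne_zero hv h.B_ne) ?_
    linear_combination hkey
  have hBν : B ^ p ^ j * N ^ (ν₀ + 1) ≠ 0 :=
    mul_ne_zero (pow_ne_zero _ h.B_ne) (pow_ne_zero _ h.N_ne)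
  have hdegE : p ^ j * B.natDegree + (ν₀ + 1) * N.natDegree < E.natDegree := by
    have h1 := congrArg natDegree hE'
    rw [natDegree_mul hBν (h.comp_ne hH0), natDegree_mul (pow_ne_zero _ h.B_ne)
      (pow_ne_zero _ h.N_ne), natDegree_comp, hH, zero_mul, natDegree_pow, natDegree_pow] at h1
    have h2 : E.natDegree ≠ 0 := by
      intro h0
      rw [eq_C_of_natDegree_eq_zero h0, derivative_C] at hE'
      exact mul_ne_zero hBν (h.comp_ne hH0) hE'.symm
    have := natDegree_derivative_lt h2
    omega
  have hsmall : p ^ j * N.natDegree + 2 * (p ^ j * B.natDegree) < L.natDegree := by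
    have h1 : p ^ j * (p ^ j * B.natDegree + (ν₀ + 1) * N.natDegree) < p ^ j * E.natDegree :=
      Nat.mul_lt_mul_of_pos_left hdegE (by omega)
    have h2 : 2 * (p ^ j * B.natDegree) ≤ p ^ j * (p ^ j * B.natDegree) :=
      Nat.mul_le_mul_right _ hP2
    have h3 : p ^ j * N.natDegree ≤ p ^ j * ((ν₀ + 1) * N.natDegree) :=
      Nat.mul_le_mul_left _ (Nat.le_mul_of_pos_left _ (Nat.succ_pos _))
    rw [mul_add] at h1
    omega
  obtain ⟨B₁, rfl⟩ := exists_pow_char_eq_of_derivative_eq_zero (p := p) hB'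
  obtain ⟨N₁, rfl⟩ := exists_pow_char_eq_of_derivative_eq_zero (p := p) hN'
  have hNB₁ : IsCoprime N₁ B₁ := (IsCoprime.pow_iff (by omega) (by omega)).1 hNB
  obtain ⟨i', ν', E₁, R', h', hE₁⟩ := h.succ_of_const hjs hR (eq_C_of_natDegree_eq_zero hH)
  refine h'.good_of_small (s - (j + 1)) (by omega) (by omega) hNB₁ ?_ ?_
  · rw [natDegree_pow, natDegree_pow] at hsmall
    rwa [pow_succ, mul_assoc, mul_assoc]
  · have h2 := congrArg natDegree hE₁
    rw [natDegree_pow] at h2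
    have h3 : (E - C (H.coeff 0) * (L * (N₁ ^ p) ^ (ν₀ + 1))).natDegree ≤ 2 * L.natDegree := by
      refine (natDegree_sub_le_of_le (le_refl E.natDegree) ((natDegree_C_mul_le _ _).trans
        (natDegree_mul_le.trans (Nat.add_le_add_left natDegree_pow_le _)))).trans ?_
      refine max_le ?_ ?_ <;> omega
    rw [← h2] at h3
    have := Nat.mul_le_mul_right E₁.natDegree hp2
    omega

end Stage

theorem eval_eq_zero_of_comp_eq {T f u D A : F[X]} {α : F} (h : T.comp f = u * derivative f)
    (hD : D.natDegree ≠ 0) (hf' : D ∣ derivative f) (hf : f - C α = D * A) : T.eval α = 0 := by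
  obtain ⟨W, hW⟩ := X_sub_C_dvd_sub_C_eval (p := T) (a := α)
  have h1 := congrArg (fun g => g.comp f) hW
  simp only [sub_comp, mul_comp, X_comp, C_comp] at h1
  have h2 : D ∣ C (T.eval α) := by
    obtain ⟨D', hD'⟩ := hf'
    exact ⟨u * D' - A * W.comp f, by rw [h, hf] at h1; rw [hD'] at h1; linear_combination -h1⟩
  by_contra hne
  have := natDegree_le_of_dvd h2 (C_ne_zero.2 hne)
  rw [natDegree_C] at this
  omega

namespace Presentation

variable {s k v : ℕ} {θ : F} {f S L N B G : F[X]}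

theorem squarefree (P : Presentation p (X * S) f k 0 v L N B G) (hk : k ≠ 0) : Squarefree L := by
  rw [P.L_eq]; exact squarefree_X_mul_pow_sub_pow P.coprime hk

theorem deriv_L (P : Presentation p (X * S) f k 0 v L N B G) (hk : k ≠ 0) :
    derivative L = B ^ p ^ k := by
  rw [P.L_eq, derivative_X_mul_pow_sub_pow B G hk]

theorem eq_mul (P : Presentation p (X * S) f k 0 v L N B G) : f = L ^ v * N ^ p ^ k := by
  rw [← P.f_eq, C_0, sub_zero]

theorem exists_stage [Finite F] (P : Presentation p (X * S) f k 0 v L N B G) (hk : k ≠ 0)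
    (hks : k ≤ s) (hS : S.natDegree ≠ 0) (hθ : θ ≠ 0) (hf' : derivative f ≠ 0)
    (heq : f * S.comp f = C θ * ((X ^ p ^ s - X) * derivative f)) :
    ∃ (i ν : ℕ) (R : F[X]), Stage p s (θ * v) v f S k i ν L N B (-G) R ∧ IsCoprime N B := by
  have hp0 : p ^ k ≠ 0 := pow_ne_zero _ (Fact.out : p.Prime).ne_zero
  have hc : θ * v ≠ 0 := mul_ne_zero hθ P.v_ne
  have hL' := P.deriv_L hk
  have hf := P.eq_mul
  have hf0 : f ≠ 0 := by rintro rfl; simp at hf'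
  have hN' := derivative_pow_char_pow (p := p) N hk
  have hLf : L * derivative f = C (v : F) * f * derivative L := by
    have := mul_derivative_pow L v
    rw [hf, derivative_mul, hN']
    linear_combination N ^ p ^ k * this
  have hN : N ≠ 0 := by rintro rfl; rw [zero_pow hp0, mul_zero] at hf; exact hf0 hf
  have hv0 : v ≠ 0 := by rintro rfl; exact P.v_ne Nat.cast_zero
  have hL0 : L ≠ 0 := by rintro rfl; rw [zero_pow hv0, zero_mul] at hf; exact hf0 hf
  have hB : B ≠ 0 := by
    rintro rfl
    rw [hL', zero_pow hp0, mul_zero] at hLf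
    exact mul_ne_zero hL0 hf' hLf
  have hLS : L * S.comp f = C (θ * v) * ((X ^ p ^ s - X) * B ^ p ^ k) := by
    refine mul_left_cancel₀ hf0 ?_
    rw [hL'] at hLf
    rw [C_mul]
    linear_combination L * heq + C θ * (X ^ p ^ s - X) * hLf
  have hS1 : S + C (θ * v) ≠ 0 := fun h0 => hS (by
    rw [eq_neg_of_add_eq_zero_left h0, natDegree_neg, natDegree_C])
  obtain ⟨ν, K, hK, hK0⟩ := exists_eq_X_pow_mul hS1
  set c := θ * v with hcdef
  have hcc : C c * C c⁻¹ = (1 : F[X]) := by rw [← C_mul, mul_inv_cancel₀ hc, C_1]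
  have hSR : S = C (-c) + C c * X ^ ν * (C c⁻¹ * K) := by
    rw [C_neg]
    linear_combination hK - X ^ ν * K * hcc
  have hst : Stage p s c v f S 0 (v * ν + 1) ν L (N ^ p ^ k) (B ^ p ^ k) ((-G) ^ p ^ k)
      (C c⁻¹ * K) := by
    refine ⟨?_, ?_, pow_ne_zero _ hB, pow_ne_zero _ hN, P.v_ne, ⟨C (-c), ?_, ?_⟩, ?_, ?_, ?_⟩
    · rw [pow_zero, pow_one]; exact hf
    · rw [pow_zero, pow_one]; exact hL'
    · rw [pow_zero, pow_one]; exact hSR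
    · intro n hn
      have : n = 0 := by
        by_contra hne
        rw [mem_support_iff, coeff_C, if_neg hne] at hn
        exact hn rfl
      exact ⟨0, by rw [this, mul_zero, zero_add, pow_zero]⟩
    · rw [coeff_C_mul]; exact mul_ne_zero (inv_ne_zero hc) hK0
    · rw [pow_zero, mul_one]
    · have h1 : (-G) ^ p ^ k = - G ^ p ^ k := by
        have := sub_pow_char_pow (p := p) (n := k) 0 G
        rwa [zero_sub, zero_pow hp0, zero_sub] at this
      have h2 := congrArg (fun g => g.comp f) hSR
      simp only [add_comp, mul_comp, pow_comp, X_comp, C_comp, C_neg, neg_comp] at h2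
      rw [h1, Nat.sub_zero, mul_comp, C_comp]
      refine mul_left_cancel₀ (C_ne_zero.2 hc) ?_
      have h3 : f ^ ν = L ^ (v * ν) * (N ^ p ^ k) ^ ν := by
        rw [hf, mul_pow, pow_mul]
      rw [h3] at h2
      have h4 := P.L_eq
      rw [pow_succ]
      linear_combination hLS - L * h2 + C c * h4
  obtain ⟨i, R, h⟩ := hst.iterate_succ_of_pow k (by omega)
  rw [zero_add] at h
  refine ⟨i, ν, R, h, ?_⟩
  have hν := h.ν_pos hk
  obtain ⟨x, y, hxy⟩ : IsCoprime L B := by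
    obtain ⟨x, y, hxy⟩ := (IsCoprime.pow_left (m := p ^ k) P.coprime.symm)
    obtain ⟨e, he⟩ := Nat.exists_eq_succ_of_ne_zero hp0
    have h4 := P.L_eq
    refine ⟨-x, y + x * X * B ^ e, ?_⟩
    rw [h4, he, pow_succ B]
    rw [he] at hxy
    linear_combination hxy
  have h2 := congrArg (fun g => g.comp f) hSR
  simp only [add_comp, mul_comp, pow_comp, X_comp, C_comp, C_neg, neg_comp] at h2
  obtain ⟨e, he⟩ := Nat.exists_eq_succ_of_ne_zero hp0
  obtain ⟨ν₀, rfl⟩ := Nat.exists_eq_succ_of_ne_zero hν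
  have h5 : IsCoprime N (C c * B) := by
    rw [he, pow_succ B] at hLS
    have h6 : f = N * (L ^ v * N ^ e) := by
      rw [he, pow_succ] at hf
      linear_combination hf
    refine ⟨x * L * (L ^ v * N ^ e) * C c * f ^ ν₀ * (C c⁻¹ * K.comp f) * C c⁻¹,
      (y - x * (X ^ p ^ s - X) * B ^ e) * C c⁻¹, ?_⟩
    rw [pow_succ] at h2
    linear_combination hxy + (x * L + y * B) * hcc + x * C c⁻¹ * hLS - x * L * C c⁻¹ * h2 -
      x * L * C c⁻¹ * (C c * f ^ ν₀ * (C c⁻¹ * K.comp f)) * h6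
  exact h5.of_mul_right_right

end Presentation

theorem exists_pow_of_wronskian [Finite F] {B G : F[X]} (hBG : IsCoprime B G) (hB : B ≠ 0)
    (hW : derivative G * B = G * derivative B) :
    ∃ B₁ G₁ : F[X], B = B₁ ^ p ∧ G = G₁ ^ p ∧ IsCoprime B₁ G₁ := by
  have hp := (Fact.out : p.Prime)
  obtain ⟨hB', hG'⟩ := derivative_eq_zero_of_wronskian hBG hB hW
  obtain ⟨B₁, rfl⟩ := exists_pow_char_eq_of_derivative_eq_zero (p := p) hB'
  obtain ⟨G₁, rfl⟩ := exists_pow_char_eq_of_derivative_eq_zero (p := p) hG'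
  exact ⟨B₁, G₁, rfl, rfl, (IsCoprime.pow_iff hp.pos hp.pos).1 hBG⟩

/-- A presentation around another root of `T` arising from a degenerate Wronskian. -/
theorem exists_presentation_of_rebase [Finite F] {T f u M g A : F[X]} {e : F} {k : ℕ}
    (hk : k ≠ 0) (hM : derivative M ≠ 0) (hf : f = X * M ^ p ^ k - g ^ p ^ k)
    (heq : T.comp f = u * derivative f) (hA : A.natDegree ≠ 0)
    (hW : derivative g * M = (g + C e) * derivative M)
    (hAf : M ^ (p ^ k + 1) * (derivative A).comp f = derivative M * (A.comp f - C e)) :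
    ∃ (α : F) (v : ℕ) (L N B G : F[X]), Presentation p T f (k + 1) α v L N B G := by
  have hp0 : p ^ k ≠ 0 := pow_ne_zero _ (Fact.out : p.Prime).ne_zero
  have hM0 : M ≠ 0 := by rintro rfl; simp at hM
  obtain ⟨D, M₁, g₁, hD, h1, h2, hco⟩ := exists_eq_gcd_mul (h := g + C e) hM0
  have hM₁ : M₁ ≠ 0 := by rintro rfl; rw [mul_zero] at h1; exact hM0 h1
  have hg' : derivative g = derivative D * g₁ + D * derivative g₁ := by
    rw [← derivative_mul, ← h2, derivative_add, derivative_C, add_zero]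
  have hM' : derivative M = derivative D * M₁ + D * derivative M₁ := by
    rw [h1, derivative_mul]
  obtain ⟨B₁, G₁, hB₁, hG₁, hBG⟩ := exists_pow_of_wronskian (p := p) hco hM₁ (by
    refine mul_left_cancel₀ (mul_ne_zero hD hD) ?_
    rw [hg', hM', h2, h1] at hW
    linear_combination hW)
  have hB₁' : derivative M₁ = 0 := by rw [hB₁, derivative_pow_char]
  rw [hB₁', mul_zero, add_zero] at hM'
  have hD' : derivative D ≠ 0 := by
    intro h0
    rw [hM', h0, zero_mul] at hM
    exact hM rfl
  set L := X * B₁ ^ p ^ (k + 1) - G₁ ^ p ^ (k + 1) with hL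
  have hLM : L = X * M₁ ^ p ^ k - g₁ ^ p ^ k := by
    rw [hL, hB₁, hG₁, ← pow_mul, ← pow_mul, ← pow_succ']
  have hfα : f - C (e ^ p ^ k) = D ^ p ^ k * L := by
    have h3 : (g + C e) ^ p ^ k = g ^ p ^ k + C (e ^ p ^ k) := by
      rw [add_pow_char_pow, C_pow]
    rw [h2] at h3
    rw [hf, hLM, h1, mul_pow]
    rw [mul_pow] at h3
    linear_combination h3
  have hLsq : Squarefree L := squarefree_X_mul_pow_sub_pow hBG (Nat.succ_ne_zero k)
  have hL' : derivative L = M₁ ^ p ^ k := by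
    rw [hL, derivative_X_mul_pow_sub_pow B₁ G₁ (Nat.succ_ne_zero k), hB₁, ← pow_mul, ← pow_succ']
  have hL'0 : derivative L ≠ 0 := by rw [hL']; exact pow_ne_zero _ hM₁
  have hLn : L.natDegree ≠ 0 := fun h0 => hL'0 (by
    rw [eq_C_of_natDegree_eq_zero h0, derivative_C])
  have hDQ := pow_ne_zero (p ^ k) hD
  set α := e ^ p ^ k with hα
  have hfd : (f - C α).natDegree = p ^ k * D.natDegree + L.natDegree := by
    rw [hfα, natDegree_mul hDQ hLsq.ne_zero, natDegree_pow]
  have hfpos : 0 < (f - C α).natDegree := by omega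
  have hA1 : A.comp (X + C α) - C e ≠ 0 := by
    intro h0
    apply hA
    have := congrArg natDegree (sub_eq_zero.1 h0)
    rwa [natDegree_comp, natDegree_X_add_C, mul_one, natDegree_C] at this
  obtain ⟨m, K, hK, hK0⟩ := exists_eq_X_pow_mul hA1
  have hAK : A.comp f - C e = (f - C α) ^ m * K.comp (f - C α) := by
    have := congrArg (fun g => g.comp (f - C α)) hK
    simpa [comp_assoc] using this
  have hAK' : (f - C α) * (derivative A).comp f =
      (f - C α) ^ m * (weightedEuler m 1 K).comp (f - C α) := by
    have h4 := congrArg (fun g => (X * derivative g).comp (f - C α)) hK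
    have h5 := mul_derivative_pow (X : F[X]) m
    have h6 : X * derivative (X ^ m * K) = X ^ m * weightedEuler m 1 K := by
      rw [weightedEuler, derivative_mul]
      rw [derivative_X] at h5
      simp only [Nat.cast_one, C_1]
      linear_combination K * h5
    rw [h6] at h4
    simpa [derivative_comp, comp_assoc] using h4
  have hkey : D * derivative L * (weightedEuler m 1 K).comp (f - C α) =
      derivative D * L * K.comp (f - C α) := by
    refine mul_left_cancel₀ (mul_ne_zero (mul_ne_zero hDQ hM₁)
      (pow_ne_zero m (ne_zero_of_natDegree_gt hfpos))) ?_
    rw [hL']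
    rw [hM', h1, mul_pow, pow_succ, pow_succ] at hAf
    linear_combination (f - C α) * hAf - D ^ p ^ k * D * M₁ ^ p ^ k * M₁ * hAK' +
      derivative D * M₁ * (f - C α) * hAK +
      derivative D * M₁ * (f - C α) ^ m * K.comp (f - C α) * hfα
  have hdeg : (D * derivative L).natDegree < (f - C α).natDegree := by
    have h7 := natDegree_derivative_lt hLn
    have h8 : (D * derivative L).natDegree ≤ D.natDegree + (derivative L).natDegree :=
      natDegree_mul_le
    have h9 := Nat.le_mul_of_pos_left D.natDegree (Nat.pos_of_ne_zero hp0)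
    omega
  obtain ⟨m', N, hN⟩ := exists_eq_pow_mul_pow hLsq hL'0 hD hdeg (b := 1) (by simp) hK0 hkey
  refine ⟨α, m' * p ^ k + 1, L, N, B₁, G₁, ?_, ?_, hL, hBG, ?_⟩
  · obtain ⟨q, hq⟩ := Nat.exists_eq_succ_of_ne_zero hp0
    refine eval_eq_zero_of_comp_eq heq (D := D) (A := D ^ q * L) ?_ ?_ ?_
    · exact fun h0 => hD' (by rw [eq_C_of_natDegree_eq_zero h0, derivative_C])
    · rw [hf, derivative_X_mul_pow_sub_pow M g hk, h1]
      exact dvd_pow (dvd_mul_right _ _) hp0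
    · rw [hfα, hq, pow_succ]; ring
  · rw [hfα]
    nth_rewrite 1 [hN]
    ring
  · simp [hk]

namespace Presentation

variable {s k v : ℕ} {θ : F} {f S L N B G : F[X]}

theorem exists_succ_of_wronskian [Finite F] {c : F} {i ν : ℕ} {R : F[X]}
    (P : Presentation p (X * S) f k 0 v L N B G) (h : Stage p s c v f S k i ν L N B (-G) R)
    (hk : k ≠ 0) (hks : k < s) (hW : derivative G * B = G * derivative B) :
    ∃ (v' : ℕ) (N' B' G' : F[X]), Presentation p (X * S) f (k + 1) 0 v' L N' B' G' := by
  have hp0 : p ^ k ≠ 0 := pow_ne_zero _ (Fact.out : p.Prime).ne_zero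
  obtain ⟨B₁, G₁, hB₁, hG₁, hBG⟩ := exists_pow_of_wronskian (p := p) P.coprime h.B_ne hW
  have h1 := h.mul_derivative_lhs (derivative_pow_char_pow (p := p) N hk)
  have h2 : derivative (L ^ i * N ^ ν * R.comp f) = 0 := by
    rw [h.eqn, derivative_add, derivative_mul, derivative_neg,
      derivative_pow_char_pow (p := p) X (Nat.sub_ne_zero_of_lt hks), hB₁, hG₁,
      derivative_pow_char, derivative_pow_char]
    simp
  rw [h2, mul_zero] at h1
  have h4 : C (v : F) * C (ν : F) + 1 = 0 := by
    rw [← C_mul, ← C_1, ← C_add, h.natCast_mul_add_one hk, C_0]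
  have h5 : N * derivative L * (weightedEuler (v * i) (v * v) R).comp f =
      derivative N * L * R.comp f := by
    have h6 : weightedEuler (v * i) (v * v) R = C (v : F) * weightedEuler i v R := by
      simp only [weightedEuler, Nat.cast_mul, C_mul]
      ring
    rw [h6, mul_comp, C_comp]
    refine mul_left_cancel₀ (mul_ne_zero (pow_ne_zero i h.L_ne) (pow_ne_zero ν h.N_ne)) ?_
    rw [pow_succ] at h1
    linear_combination -C (v : F) * h1 - derivative N * L * (L ^ i * N ^ ν * R.comp f) * h4
  have hL' : derivative L ≠ 0 := by rw [h.deriv_L]; exact pow_ne_zero _ h.B_ne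
  have hdeg : (N * derivative L).natDegree < f.natDegree := by
    have h7 : L.natDegree ≠ 0 := fun h0 => hL' (by
      rw [eq_C_of_natDegree_eq_zero h0, derivative_C])
    have h7 := natDegree_derivative_lt h7
    have h8 : (N * derivative L).natDegree ≤ N.natDegree + (derivative L).natDegree :=
      natDegree_mul_le
    have h9 := Nat.le_mul_of_pos_left N.natDegree (Nat.pos_of_ne_zero hp0)
    have h10 := h.natDegree_f
    have h11 := Nat.le_mul_of_pos_left L.natDegree h.v_pos
    omega
  obtain ⟨m, N₁, hN⟩ := exists_eq_pow_mul_pow (P.squarefree hk) hL' h.N_ne hdeg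
    (b := v * v) (by rw [Nat.cast_mul]; exact mul_ne_zero h.v_ne h.v_ne) h.R_zero h5
  refine ⟨m * p ^ k + v, N₁, B₁, G₁, P.root, ?_, ?_, hBG, ?_⟩
  · rw [P.f_eq]
    nth_rewrite 1 [hN]
    ring
  · rw [P.L_eq, hB₁, hG₁, ← pow_mul, ← pow_mul, ← pow_succ']
  · simp [hk, h.v_ne]

/-- Either the descent terminates or there is a presentation with a larger exponent. -/
theorem good_or_exists_succ [Finite F] (P : Presentation p (X * S) f k 0 v L N B G) (hk : k ≠ 0)
    (hks : k ≤ s) (hS : S.natDegree ≠ 0) (hθ : θ ≠ 0) (hf' : derivative f ≠ 0)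
    (heq : f * S.comp f = C θ * ((X ^ p ^ s - X) * derivative f)) :
    (∀ n ∈ S.support, ∃ a, v * n + 1 = p ^ a) ∨ (k < s ∧ ∃ (α : F) (v' : ℕ) (L' N' B' G' : F[X]),
      Presentation p (X * S) f (k + 1) α v' L' N' B' G') := by
  have hp2 : 2 ≤ p := (Fact.out : p.Prime).two_le
  have hQ2 : 2 ≤ p ^ k := hp2.trans (Nat.le_self_pow hk p)
  obtain ⟨i, ν, R, h, hNB⟩ := P.exists_stage hk hks hS hθ hf' heq
  have hG : p ^ k * (-G).natDegree ≤ L.natDegree := by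
    rw [natDegree_neg, P.L_eq]; exact natDegree_G_le hk h.B_ne
  have hGQ : 2 * (-G).natDegree ≤ p ^ k * (-G).natDegree := Nat.mul_le_mul_right _ hQ2
  have hBQ : 2 * B.natDegree ≤ p ^ k * B.natDegree := Nat.mul_le_mul_right _ hQ2
  have hNQ : 2 * N.natDegree ≤ p ^ k * N.natDegree := Nat.mul_le_mul_right _ hQ2
  have hBL := h.natDegree_B_lt
  have hd := h.natDegree_f
  rcases hks.eq_or_lt with rfl | hks
  · exact Or.inl (h.good_of_eq (by omega))
  by_cases hW : derivative G * B = G * derivative B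
  · obtain ⟨v', N', B', G', P'⟩ := P.exists_succ_of_wronskian h hk hks hW
    exact Or.inr ⟨hks, 0, v', L, N', B', G', P'⟩
  set Δ := derivative (-G) * B - -G * derivative B with hΔ
  have hΔ0 : Δ ≠ 0 := by
    intro h0
    rw [hΔ, derivative_neg] at h0
    exact hW (by linear_combination -h0)
  have hΔdeg : Δ.natDegree < L.natDegree := by
    have : Δ.natDegree ≤ _ := Stage.natDegree_wronskian_le (-G) B
    omega
  have hv : (C (v : F)) ≠ 0 := C_ne_zero.2 h.v_ne
  have hLΔ : ¬ L ∣ C (v : F) * Δ := by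
    intro h0
    have := natDegree_le_of_dvd h0 (mul_ne_zero hv hΔ0)
    rw [natDegree_C_mul h.v_ne] at this
    omega
  obtain ⟨i₀, rfl⟩ : ∃ i₀, i = i₀ + 1 := Nat.exists_eq_succ_of_ne_zero h.i_pos.ne'
  obtain ⟨ν₀, rfl⟩ : ∃ ν₀, ν = ν₀ + 1 := Nat.exists_eq_succ_of_ne_zero (h.ν_pos hk)
  have hkey := h.key_identity hk hks
  rw [← hΔ] at hkey
  obtain rfl : i₀ = 0 := by
    by_contra hne
    obtain ⟨e, rfl⟩ := Nat.exists_eq_succ_of_ne_zero hne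
    apply hLΔ
    refine ⟨C (v : F) * B ^ (p ^ k + 1) * (L ^ e * N ^ (ν₀ + 1)) *
      (weightedEuler (e + 1 + 1) v R).comp f - (C (v : F) * (N * derivative B) + derivative N * B) *
      (L ^ (e + 1) * N ^ ν₀) * R.comp f, ?_⟩
    simp only [Nat.succ_eq_add_one] at hkey
    generalize weightedEuler (e + 1 + 1) v R = H at hkey ⊢
    linear_combination hkey
  rw [zero_add, pow_one, pow_zero, one_mul] at hkey
  rw [zero_add] at h
  by_cases hR : R.natDegree = 0
  · exact Or.inl (h.good_of_natDegree_eq_zero rfl hR)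
  by_cases hH : (weightedEuler 1 v R).natDegree = 0
  · exact Or.inl (h.good_of_const hk hks hNB hG hR hH)
  refine Or.inr ⟨hks, ?_⟩
  have hidx := h.idx
  have hNB' : (C (v : F) * (N * derivative B) + derivative N * B).natDegree ≤
      N.natDegree + B.natDegree := by
    have h1 := natDegree_derivative_le N
    have h2 := natDegree_derivative_le B
    refine natDegree_add_le_of_degree_le ?_ (natDegree_mul_le.trans (by omega))
    exact (natDegree_C_mul_le _ _).trans (natDegree_mul_le.trans (by omega))
  obtain rfl | hv2 : v = 1 ∨ 2 ≤ v := by have := h.v_pos; omega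
  · rw [one_mul, one_mul] at hidx
    simp only [Nat.cast_one, C_1, one_mul] at hkey hNB'
    have hf : f = L * N ^ p ^ k := by rw [P.eq_mul, pow_one]
    have hfX : f = X * (B * N) ^ p ^ k - (G * N) ^ p ^ k := by
      rw [hf, P.L_eq, mul_pow, mul_pow]; ring
    have hM' : derivative (B * N) = N * derivative B + derivative N * B := by
      rw [derivative_mul]; ring
    have hXR : weightedEuler 1 1 R = derivative (X * R) := by
      rw [weightedEuler, derivative_mul, derivative_X]; simp
    have h1 : (B * N) ^ (p ^ k + 1) * (weightedEuler 1 1 R).comp f =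
        derivative (B * N) * (X * R).comp f + N ^ 2 * Δ := by
      rw [hM', mul_comp, X_comp]
      nth_rewrite 2 [hf]
      rw [← hidx]
      rw [← hidx] at hkey
      linear_combination -N ^ 2 * hkey
    have hB' : (derivative (B * N)).natDegree < f.natDegree := by rw [hM']; omega
    have hδ : (N ^ 2 * Δ).natDegree < f.natDegree := by
      have h2 : (N ^ 2 * Δ).natDegree ≤ 2 * N.natDegree + Δ.natDegree := by
        rw [← natDegree_pow]; exact natDegree_mul_le
      omega
    obtain ⟨e, he⟩ := eq_C_mul_of_comp_eq hH h1 hB' hδ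
    have hM0 : derivative (B * N) ≠ 0 := by
      intro h0
      rw [h0, mul_zero] at he
      exact mul_ne_zero (pow_ne_zero 2 h.N_ne) hΔ0 he
    refine exists_presentation_of_rebase (e := -e) (A := X * R) (u := C θ * (X ^ p ^ s - X)) hk hM0
      hfX ?_ ?_ ?_ ?_
    · rw [mul_comp, X_comp, heq, mul_assoc]
    · rw [natDegree_X_mul h.R_ne]; exact Nat.succ_ne_zero _
    · rw [hΔ, derivative_neg, hM'] at he
      rw [C_neg, hM', derivative_mul]
      linear_combination -he
    · rw [← hXR, h1, he, C_neg]; ring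
  · exfalso
    set U := C (v : F) * (N * derivative B) + derivative N * B with hU
    have h1 : C (v : F) * B ^ (p ^ k + 1) * N ^ (ν₀ + 1) * (weightedEuler 1 v R).comp f =
        U * (L * N ^ ν₀) * R.comp f + C (v : F) * Δ := hkey.symm
    have h2 : 2 * L.natDegree ≤ v * L.natDegree := Nat.mul_le_mul_right _ hv2
    have h3 : (ν₀ + 1) * N.natDegree ≤ p ^ k * N.natDegree := by
      refine Nat.mul_le_mul_right _ ?_
      have := Nat.le_mul_of_pos_left (ν₀ + 1) h.v_pos
      omega
    have h4 : (U * (L * N ^ ν₀)).natDegree ≤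
        N.natDegree + B.natDegree + (L.natDegree + ν₀ * N.natDegree) :=
      natDegree_mul_le.trans (Nat.add_le_add hNB'
        (natDegree_mul_le.trans (Nat.add_le_add_left natDegree_pow_le _)))
    rw [add_mul, one_mul] at h3
    obtain ⟨e, he⟩ := eq_C_mul_of_comp_eq hH h1 (by omega)
      ((natDegree_C_mul_le _ _).trans_lt (by omega))
    exact hLΔ ⟨C e * U * N ^ ν₀, by rw [he]; ring⟩

end Presentation

theorem Presentation.exists_good_or_exists_succ [Finite F] {T f : F[X]} {θ : F} {s k v : ℕ}
    {γ : F} {L N B G : F[X]} (P : Presentation p T f k γ v L N B G) (hk : k ≠ 0) (hks : k ≤ s)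
    (hθ : θ ≠ 0) (hT : 2 ≤ T.natDegree) (hf' : derivative f ≠ 0)
    (heq : T.comp f = C θ * ((X ^ p ^ s - X) * derivative f)) :
    (∃ S : F[X], T.comp (X + C γ) = X * S ∧ ∀ n ∈ S.support, ∃ a, v * n + 1 = p ^ a) ∨
    (k < s ∧ ∃ (γ' : F) (v' : ℕ) (L' N' B' G' : F[X]),
      Presentation p T f (k + 1) γ' v' L' N' B' G') := by
  obtain ⟨S, hS⟩ : X ∣ T.comp (X + C γ) := by
    rw [X_dvd_iff, coeff_zero_eq_eval_zero, eval_comp]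
    simpa using P.root
  have hS' : S.natDegree ≠ 0 := by
    intro h0
    have h1 := congrArg natDegree hS
    have h2 := natDegree_mul_le (p := X) (q := S)
    rw [natDegree_comp, natDegree_X_add_C] at h1
    rw [natDegree_X] at h2
    omega
  have P' : Presentation p (X * S) (f - C γ) k 0 v L N B G :=
    ⟨by simp, by rw [C_0, sub_zero]; exact P.f_eq, P.L_eq, P.coprime, P.v_ne⟩
  have hTf : (f - C γ) * S.comp (f - C γ) =
      C θ * ((X ^ p ^ s - X) * derivative (f - C γ)) := by
    have h3 := congrArg (fun g => g.comp (f - C γ)) hS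
    rw [derivative_sub, derivative_C, sub_zero, ← heq]
    simpa [comp_assoc] using h3.symm
  rcases P'.good_or_exists_succ hk hks hS' hθ (by simpa using hf') hTf with
    h | ⟨h, α, v', L', N', B', G', Q⟩
  · exact Or.inl ⟨S, hS, h⟩
  · refine Or.inr ⟨h, γ + α, v', L', N', B', G', ?_, ?_, Q.L_eq, Q.coprime, Q.v_ne⟩
    · have := Q.root
      rw [← hS, eval_comp] at this
      simpa [add_comm] using this
    · rw [← Q.f_eq, C_add]; ring

theorem Presentation.exists_good [Finite F] {T f : F[X]} {θ : F} {s : ℕ} (hθ : θ ≠ 0)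
    (hT : 2 ≤ T.natDegree) (hf' : derivative f ≠ 0)
    (heq : T.comp f = C θ * ((X ^ p ^ s - X) * derivative f)) (t : ℕ) :
    ∀ {k : ℕ} {γ : F} {v : ℕ} {L N B G : F[X]}, Presentation p T f k γ v L N B G → k ≠ 0 →
    k + t = s → ∃ (γ : F) (v : ℕ) (S : F[X]), (v : F) ≠ 0 ∧ T.comp (X + C γ) = X * S ∧
      ∀ n ∈ S.support, ∃ a, v * n + 1 = p ^ a := by
  induction t with
  | zero =>
    intro k γ v L N B G P hk hks
    rcases P.exists_good_or_exists_succ hk (by omega) hθ hT hf' heq with ⟨S, hS, h⟩ | ⟨h, -⟩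
    · exact ⟨γ, v, S, P.v_ne, hS, h⟩
    · omega
  | succ t ih =>
    intro k γ v L N B G P hk hks
    rcases P.exists_good_or_exists_succ hk (by omega) hθ hT hf' heq with
      ⟨S, hS, h⟩ | ⟨-, γ', v', L', N', B', G', Q⟩
    · exact ⟨γ, v, S, P.v_ne, hS, h⟩
    · exact ih Q (Nat.succ_ne_zero k) (by omega)

/-- The local analysis of `T.comp f = θ u f'` at a root `γ` of `T`. -/
theorem exists_factorization_at_root [Finite F] {T₁ f u : F[X]} {γ θ : F} (hθ : θ ≠ 0)
    (hu : derivative u = -1) (hf' : derivative f ≠ 0) (hc : T₁.eval γ ≠ 0)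
    (heq : (f - C γ) * T₁.comp f = C θ * (u * derivative f)) :
    ∃ (e : ℕ) (L u₁ N : F[X]), 0 < e ∧ e < p ∧ (e : F) * θ = -T₁.eval γ ∧ u = L * u₁ ∧
      f - C γ = L ^ e * N ^ p ∧ T₁.comp f = C (θ * e) * (u₁ * derivative L) ∧
      IsCoprime u₁ (f - C γ) ∧ C (e : F) * ((f - C γ) * derivative L) = derivative f * L ∧
      IsCoprime L (derivative L) := by
  have hp := (Fact.out : p.Prime)
  set h := f - C γ with hh
  set c := T₁.eval γ with hcdef
  have hh' : derivative h = derivative f := by rw [hh, derivative_sub, derivative_C, sub_zero]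
  rw [← hh'] at heq hf' ⊢
  have hh0 : h ≠ 0 := by intro h0; rw [h0, derivative_zero] at hf'; exact hf' rfl
  have hu0 : u ≠ 0 := by
    rintro rfl
    rw [derivative_zero] at hu
    exact one_ne_zero (neg_eq_zero.1 hu.symm)
  obtain ⟨L, u₁, h₁, hL, hLu, hLh, hco⟩ := exists_eq_gcd_mul (h := h) hu0
  have hu' : derivative L * u₁ + L * derivative u₁ = -1 := by rw [← derivative_mul, ← hLu, hu]
  have hu₁L : IsCoprime u₁ L := ⟨-derivative L, -derivative u₁, by linear_combination -hu'⟩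
  have hu₁h : IsCoprime u₁ h := by rw [hLh]; exact hu₁L.mul_right hco
  have hsep : IsCoprime L (derivative L) := ⟨-derivative u₁, -u₁, by linear_combination -hu'⟩
  obtain ⟨a, ha⟩ : h ∣ L * derivative h := by
    refine hu₁h.symm.dvd_of_dvd_mul_left ⟨C θ⁻¹ * T₁.comp f, ?_⟩
    have h1 : C θ * C θ⁻¹ = (1 : F[X]) := by rw [← C_mul, mul_inv_cancel₀ hθ, C_1]
    rw [hLu] at heq
    linear_combination -C θ⁻¹ * heq - u₁ * (L * derivative h) * h1
  obtain ⟨b, hb⟩ : h ∣ T₁.comp f - C c := by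
    obtain ⟨W, hW⟩ := X_sub_C_dvd_sub_C_eval (p := T₁) (a := γ)
    have h1 := congrArg (fun g => g.comp f) hW
    simp only [sub_comp, mul_comp, X_comp, C_comp] at h1
    exact ⟨_, h1⟩
  have hK : C θ * (L * derivative h) + C c * (h * derivative L) = 0 := by
    refine eq_zero_of_dvd_of_degree_lt (p := h * L) ?_ ?_
    · refine ⟨-(h₁ * derivative L * b) - C θ * derivative u₁ * a, ?_⟩
      rw [hLu] at heq
      linear_combination derivative L * heq - h * derivative L * hb
        - h * derivative L * b * hLh - C θ * L * derivative u₁ * ha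
        + C θ * (L * derivative h) * hu'
    · refine (degree_add_le _ _).trans_lt (max_lt ?_ ?_)
      · rw [degree_C_mul hθ, mul_comm, degree_mul, degree_mul]
        exact WithBot.add_lt_add_right (by simpa using hL) (degree_derivative_lt hh0)
      · rw [degree_C_mul hc, degree_mul, degree_mul]
        exact WithBot.add_lt_add_left (by simpa using hh0) (degree_derivative_lt hL)
  have hLu' : ¬ IsUnit L := by
    intro hun
    obtain ⟨r, -, hr⟩ := isUnit_iff.1 hun
    rw [← hr, derivative_C, mul_zero, mul_zero, add_zero, hr] at hK
    exact mul_ne_zero (C_ne_zero.2 hθ) (mul_ne_zero hL hf') hK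
  obtain ⟨π, hπ, L₂, hL₂⟩ := WfDvdMonoid.exists_irreducible_factor hLu' hL
  obtain ⟨w, h₃, hh₃, hw⟩ : ∃ (w : ℕ) (h₃ : F[X]), ¬ π ∣ h₃ ∧ h = π ^ w * h₃ := by
    obtain ⟨w', h1, h2⟩ :=
      (FiniteMultiplicity.of_not_isUnit hπ.not_isUnit hh0).exists_eq_pow_mul_and_not_dvd
    exact ⟨_, w', h2, h1⟩
  have hwc : (w : F) * θ = -c := by
    have e1 := mul_derivative_pow π w
    have h1 : π ∣ C (θ * w + c) * (derivative π * L₂ * h₃) := by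
      refine ⟨-C θ * L₂ * derivative h₃ - C c * h₃ * derivative L₂, ?_⟩
      refine mul_left_cancel₀ (pow_ne_zero w hπ.ne_zero) ?_
      rw [hL₂, hw, derivative_mul, derivative_mul] at hK
      rw [C_add, C_mul]
      linear_combination hK - C θ * L₂ * h₃ * e1
    have h2 : ¬ π ∣ derivative π * L₂ := by
      intro h2
      have h3 : π ∣ derivative L := by
        rw [hL₂, derivative_mul]; exact dvd_add h2 (dvd_mul_right _ _)
      exact hπ.not_isUnit (hsep.isUnit_of_dvd' ⟨L₂, hL₂⟩ h3)
    rcases hπ.prime.dvd_or_dvd h1 with h3 | h3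
    · by_contra hne
      refine hπ.not_isUnit (isUnit_of_dvd_unit h3 (isUnit_C.2 (Ne.isUnit fun h0 => hne ?_)))
      linear_combination h0
    · rcases hπ.prime.dvd_or_dvd h3 with h3 | h3
      · exact absurd h3 h2
      · exact absurd h3 hh₃
  have hwL : C (w : F) * (h * derivative L) = derivative h * L := by
    refine mul_left_cancel₀ (C_ne_zero.2 hθ) ?_
    have h1 : C (w : F) * C θ = -C c := by rw [← C_mul, hwc, C_neg]
    linear_combination -hK + h * derivative L * h1
  obtain ⟨N, hN⟩ := eq_pow_mul_pow_of_mul_derivative (p := p) (Separable.squarefree hsep) hwL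
  have hwe : ((w % p : ℕ) : F) = w := by
    conv_rhs => rw [← Nat.div_add_mod w p]
    simp
  refine ⟨w % p, L, u₁, N, ?_, Nat.mod_lt _ hp.pos, by rw [hwe, hwc], hLu, hN, ?_, hu₁h, ?_, hsep⟩
  · rcases Nat.eq_zero_or_pos (w % p) with h0 | h0
    · rw [h0, Nat.cast_zero] at hwe
      rw [← hwe, zero_mul] at hwc
      exact absurd (neg_eq_zero.1 hwc.symm) hc
    · exact h0
  · refine mul_left_cancel₀ hh0 ?_
    rw [hwe, heq, C_mul, hLu]
    linear_combination -C θ * u₁ * hwL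
  · rw [hwe]; exact hwL

theorem eval_derivative_eq_neg_of_ne (p : ℕ) [Fact p.Prime] [CharP F p] [Finite F]
    {T f u : F[X]} {γ δ θ : F} (hθ : θ ≠ 0)
    (hu : derivative u = -1) (hf' : derivative f ≠ 0)
    (hTγ : T.eval γ = 0) (hTδ : T.eval δ = 0) (hγδ : γ ≠ δ)
    (hcγ : (derivative T).eval γ ≠ 0) (hcδ : (derivative T).eval δ ≠ 0)
    (hTf : T.comp f ≠ 0) (heq : T.comp f = C θ * (u * derivative f))
    (hγ : (derivative T).eval γ ≠ -θ) : (derivative T).eval δ = -θ := by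
  by_contra hδ
  obtain ⟨T₁, hT₁⟩ := dvd_iff_isRoot.2 hTγ
  obtain ⟨T₂, hT₂⟩ := dvd_iff_isRoot.2 hTδ
  have h1 : (derivative T).eval γ = T₁.eval γ := by rw [hT₁]; simp
  have h2 : (derivative T).eval δ = T₂.eval δ := by rw [hT₂]; simp
  have hf1 : (f - C γ) * T₁.comp f = C θ * (u * derivative f) := by
    rw [← heq, hT₁]; simp
  have hf2 : (f - C δ) * T₂.comp f = C θ * (u * derivative f) := by
    rw [← heq, hT₂]; simp
  rw [h1] at hcγ hγ
  rw [h2] at hcδ hδ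
  obtain ⟨e₁, L₁, u₁, N₁, he₁, -, hc₁, hu₁, hh₁, hT₁f, hco₁, -, -⟩ :=
    exists_factorization_at_root (p := p) hθ hu hf' hcγ hf1
  obtain ⟨e₂, L₂, u₂, N₂, he₂, -, hc₂, hu₂, hh₂, -, hco₂, -, -⟩ :=
    exists_factorization_at_root (p := p) hθ hu hf' hcδ hf2
  have he₁' : 2 ≤ e₁ := by
    by_contra hlt
    obtain rfl : e₁ = 1 := by omega
    rw [Nat.cast_one, one_mul] at hc₁
    exact hγ (by rw [hc₁, neg_neg])
  have he₂' : 2 ≤ e₂ := by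
    by_contra hlt
    obtain rfl : e₂ = 1 := by omega
    rw [Nat.cast_one, one_mul] at hc₂
    exact hδ (by rw [hc₂, neg_neg])
  have hT₁0 : T₁.comp f ≠ 0 := by
    intro h0
    rw [h0, mul_zero, ← heq] at hf1
    exact hTf hf1.symm
  have hL₁' : derivative L₁ ≠ 0 := by
    intro h0
    rw [h0, mul_zero, mul_zero] at hT₁f
    exact hT₁0 hT₁f
  have hh : IsCoprime (f - C γ) (f - C δ) := by
    have hne : δ - γ ≠ 0 := sub_ne_zero.2 hγδ.symm
    have h3 : C (δ - γ)⁻¹ * C (δ - γ) = (1 : F[X]) := by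
      rw [← C_mul, inv_mul_cancel₀ hne, C_1]
    rw [C_sub] at h3
    exact ⟨C (δ - γ)⁻¹, -C (δ - γ)⁻¹, by linear_combination h3⟩
  obtain ⟨m, hm⟩ : L₂ ∣ f - C δ := by
    rw [hh₂]; exact (dvd_pow_self L₂ (by omega)).mul_right _
  have hL₁h : L₁ ∣ f - C γ := by
    rw [hh₁]; exact (dvd_pow_self L₁ (by omega)).mul_right _
  have hLL : IsCoprime L₂ L₁ :=
    (hh.of_isCoprime_of_dvd_left hL₁h).symm.of_isCoprime_of_dvd_left ⟨m, hm⟩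
  have hfδ : f - C δ ≠ 0 := by
    intro h0
    rw [sub_eq_zero.1 h0, derivative_C] at hf'
    exact hf' rfl
  have hfγ : f - C γ ≠ 0 := by
    intro h0
    rw [sub_eq_zero.1 h0, derivative_C] at hf'
    exact hf' rfl
  have hL₂0 : L₂ ≠ 0 := by rintro rfl; rw [zero_mul] at hm; exact hfδ hm
  obtain ⟨r, hr⟩ : L₂ ∣ u₁ := hLL.dvd_of_dvd_mul_left ⟨u₂, by rw [← hu₁, hu₂]⟩
  have hru₂ : r ∣ u₂ := ⟨L₁, by
    refine mul_left_cancel₀ hL₂0 ?_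
    rw [← hu₂, hu₁, hr]; ring⟩
  have hTδ₁ : (f - C δ) ∣ T₁.comp f := by
    have h3 : T₁.eval δ = 0 := by
      rw [hT₁] at hTδ
      simpa [sub_ne_zero.2 hγδ.symm] using hTδ
    obtain ⟨W, rfl⟩ := dvd_iff_isRoot.2 h3
    exact ⟨W.comp f, by simp⟩
  have hmL : m ∣ derivative L₁ := by
    have h3 : IsCoprime m (C (θ * e₁) * r) := by
      refine IsCoprime.mul_right (isCoprime_C (mul_ne_zero hθ ?_) m) ?_
      · intro h0
        rw [h0, zero_mul] at hc₁
        exact hcγ (neg_eq_zero.1 hc₁.symm)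
      · exact ((hco₂.of_isCoprime_of_dvd_left hru₂).of_isCoprime_of_dvd_right
          ⟨L₂, by rw [hm, mul_comm]⟩).symm
    refine h3.dvd_of_dvd_mul_left ?_
    obtain ⟨W, hW⟩ := hTδ₁
    refine ⟨W, mul_left_cancel₀ hL₂0 ?_⟩
    rw [hT₁f, hm, hr] at hW
    linear_combination hW
  have hd₁ := natDegree_le_of_dvd hmL hL₁'
  have hL₁n : L₁.natDegree ≠ 0 := fun h0 => hL₁' (by
    rw [eq_C_of_natDegree_eq_zero h0, derivative_C])
  have hd₂ := natDegree_derivative_lt hL₁n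
  have hm0 : m ≠ 0 := by rintro rfl; rw [mul_zero] at hm; exact hfδ hm
  have hd₃ := congrArg natDegree hm
  rw [natDegree_mul hL₂0 hm0, natDegree_sub_C] at hd₃
  have hd₄ := natDegree_le_of_dvd (⟨_, hh₁⟩ : L₁ ^ e₁ ∣ f - C γ) hfγ
  have hd₅ := natDegree_le_of_dvd (⟨_, hh₂⟩ : L₂ ^ e₂ ∣ f - C δ) hfδ
  rw [natDegree_pow, natDegree_sub_C] at hd₄ hd₅
  have hd₆ := Nat.mul_le_mul_right L₁.natDegree he₁'
  have hd₇ := Nat.mul_le_mul_right L₂.natDegree he₂'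
  omega

theorem exists_presentation [Finite F] {T f u : F[X]} {θ : F} (hθ : θ ≠ 0)
    (hu : derivative u = -1) (hT : 2 < T.natDegree)
    (hsplit : Multiset.card T.roots = T.natDegree) (hsep : T.roots.Nodup)
    (hTf : T.comp f ≠ 0) (heq : T.comp f = C θ * (u * derivative f)) :
    ∃ (γ : F) (v : ℕ) (L N B G : F[X]), Presentation p T f 1 γ v L N B G := by
  classical
  have hp := (Fact.out : p.Prime)
  have hT0 : T ≠ 0 := by rintro rfl; simp at hT
  have hf' : derivative f ≠ 0 := by
    intro h0
    rw [h0, mul_zero, mul_zero] at heq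
    exact hTf heq
  have hu0 : u ≠ 0 := by
    rintro rfl
    rw [derivative_zero] at hu
    exact one_ne_zero (neg_eq_zero.1 hu.symm)
  have hmem : ∀ {δ}, δ ∈ T.roots.toFinset ↔ T.eval δ = 0 := fun {δ} => by
    rw [Multiset.mem_toFinset, mem_roots hT0, IsRoot.def]
  have hcard : T.roots.toFinset.card = T.natDegree := by
    rw [Multiset.toFinset_card_of_nodup hsep, hsplit]
  have hsimple : ∀ δ, T.eval δ = 0 → (derivative T).eval δ ≠ 0 := by
    intro δ hδ h0
    have h1 := (one_lt_rootMultiplicity_iff_isRoot hT0).2 ⟨hδ, h0⟩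
    rw [← count_roots] at h1
    have := Multiset.nodup_iff_count_le_one.1 hsep δ
    omega
  obtain ⟨γ, hγ, hγδ⟩ : ∃ γ, T.eval γ = 0 ∧
      ∀ δ, T.eval δ = 0 → δ ≠ γ → (derivative T).eval δ = -θ := by
    by_cases hex : ∃ γ, T.eval γ = 0 ∧ (derivative T).eval γ ≠ -θ
    · obtain ⟨γ, hγ, hγθ⟩ := hex
      exact ⟨γ, hγ, fun δ hδ hne => eval_derivative_eq_neg_of_ne p hθ hu hf' hγ hδ hne.symm
        (hsimple γ hγ) (hsimple δ hδ) hTf heq hγθ⟩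
    · obtain ⟨γ, hγ⟩ := Finset.card_pos.1 (show 0 < T.roots.toFinset.card by omega)
      refine ⟨γ, hmem.1 hγ, fun δ hδ _ => ?_⟩
      by_contra hne
      exact hex ⟨δ, hδ, hne⟩
  obtain ⟨T₁, hT₁⟩ := dvd_iff_isRoot.2 hγ
  have hT' : derivative T = T₁ + (X - C γ) * derivative T₁ := by rw [hT₁]; simp
  have h1 : (derivative T).eval γ = T₁.eval γ := by rw [hT']; simp
  have hf1 : (f - C γ) * T₁.comp f = C θ * (u * derivative f) := by
    rw [← heq, hT₁]; simp
  obtain ⟨e, L, u₁, N, he, hep, hc, hu₁, hh, hT₁f, -, hhL, hLsep⟩ :=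
    exists_factorization_at_root (p := p) hθ hu hf' (h1 ▸ hsimple γ hγ) hf1
  have he0 : (e : F) ≠ 0 := fun h0 =>
    absurd (Nat.le_of_dvd he ((CharP.cast_eq_zero_iff F p e).1 h0)) (by omega)
  have hW : C (1 - (e : F)) * T₁ + C (e : F) * (derivative T + C θ) = 0 := by
    refine eq_zero_of_natDegree_lt_card_of_eval_eq_zero' _ T.roots.toFinset ?_ ?_
    · intro δ hδ
      rcases eq_or_ne δ γ with rfl | hne
      · simp only [eval_add, eval_mul, eval_C, h1]
        linear_combination hc
      · have h2 : T₁.eval δ = 0 := by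
          have h3 := hmem.1 hδ
          rw [hT₁] at h3
          simpa [sub_ne_zero.2 hne] using h3
        simp [h2, hγδ δ (hmem.1 hδ) hne]
    · rw [hcard]
      have h2 : T.natDegree = T₁.natDegree + 1 := by
        have h3 : T₁ ≠ 0 := by rintro rfl; rw [mul_zero] at hT₁; exact hT0 hT₁
        conv_lhs => rw [hT₁]
        rw [natDegree_mul (X_sub_C_ne_zero γ) h3, natDegree_X_sub_C, add_comm]
      have h3 := natDegree_derivative_lt (show T.natDegree ≠ 0 by omega)
      refine Nat.lt_of_le_pred (by omega) (natDegree_add_le_of_degree_le ?_ ?_)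
      · exact (natDegree_C_mul_le _ _).trans (by rw [h2]; rfl)
      · refine (natDegree_C_mul_le _ _).trans (natDegree_add_le_of_degree_le ?_ ?_)
        · exact Nat.le_pred_of_lt h3
        · rw [natDegree_C]; exact Nat.zero_le _
  have hWf : T₁.comp f + C (e : F) * ((f - C γ) * (derivative T₁).comp f) =
      -(C (e : F) * C θ) := by
    rw [hT', C_sub, C_1] at hW
    have h2 := congrArg (fun g => g.comp f) hW
    simp only [add_comp, mul_comp, sub_comp, C_comp, X_comp, one_comp, zero_comp] at h2
    linear_combination h2
  have hLT : L * T₁.comp f = C θ * C (e : F) * (u * derivative L) := by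
    rw [hT₁f, C_mul, hu₁]; ring
  have hL'' : derivative (derivative L) = 0 := by
    have h2 := congrArg derivative hLT
    simp only [derivative_mul, derivative_comp, derivative_C, hu, zero_mul, mul_zero,
      zero_add] at h2
    refine (mul_eq_zero.1 (?_ : C θ * C (e : F) * u * _ = 0)).resolve_left
      (mul_ne_zero (mul_ne_zero (C_ne_zero.2 hθ) (C_ne_zero.2 he0)) hu0)
    linear_combination derivative L * hWf - h2 - (derivative T₁).comp f * hhL
  obtain ⟨B, hB⟩ := exists_pow_char_eq_of_derivative_eq_zero (p := p) hL''
  obtain ⟨G, hG⟩ := exists_pow_char_eq_of_derivative_eq_zero (p := p) (g := X * B ^ p - L) (by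
    rw [derivative_sub, derivative_mul, derivative_pow_char, hB]; simp)
  refine ⟨γ, e, L, N, B, G, hγ, by rw [pow_one]; exact hh, ?_, ?_, he0⟩
  · rw [pow_one, hG]; ring
  · obtain ⟨x, y, hxy⟩ := hLsep
    refine (IsCoprime.pow_iff hp.pos hp.pos).1 (⟨x * X + y, -x, ?_⟩ : IsCoprime (B ^ p) (G ^ p))
    rw [← hB] at hxy
    rw [hG]
    linear_combination hxy

theorem exists_eq_sum_of_good {S : F[X]} {v : ℕ} (hv : (v : F) ≠ 0)
    (hS : ∀ n ∈ S.support, ∃ a, v * n + 1 = p ^ a) :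
    ∃ k m : ℕ, 0 < k ∧ 0 < m ∧ 0 < v ∧ v ∣ p ^ k - 1 ∧ ∃ ω : ℕ → F,
      X ^ v * S.comp (X ^ v) =
        X ^ (v - 1) * ∑ i ∈ Finset.range (m + 1), C (ω i) * X ^ p ^ (k * i) := by
  have hp := (Fact.out : p.Prime)
  have hv0 : 0 < v := by
    rcases Nat.eq_zero_or_pos v with rfl | h
    · exact absurd Nat.cast_zero hv
    · exact h
  have hpv : p.Coprime v := by
    rw [hp.coprime_iff_not_dvd]
    exact fun h => hv ((CharP.cast_eq_zero_iff F p v).2 h)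
  have : NeZero v := ⟨hv0.ne'⟩
  set k := orderOf (ZMod.unitOfCoprime p hpv) with hk
  have hmod : ∀ a, v ∣ p ^ a - 1 ↔ k ∣ a := by
    intro a
    rw [hk, orderOf_dvd_iff_pow_eq_one, ← Nat.modEq_iff_dvd' (Nat.one_le_pow _ _ hp.pos),
      ← ZMod.natCast_eq_natCast_iff, Units.ext_iff]
    simp [eq_comm]
  have hk0 : 0 < k := orderOf_pos _
  have hdvd : ∀ i, v ∣ p ^ (k * i) - 1 := fun i => (hmod _).2 (dvd_mul_right _ _)
  set g : ℕ → ℕ := fun i => (p ^ (k * i) - 1) / v with hg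
  have hgi : ∀ i, v * g i + 1 = p ^ (k * i) := by
    intro i
    rw [hg, Nat.mul_div_cancel' (hdvd i), Nat.sub_add_cancel (Nat.one_le_pow _ _ hp.pos)]
  have hginj : Function.Injective g := by
    intro i i' hii
    have h1 : p ^ (k * i) = p ^ (k * i') := by rw [← hgi, ← hgi, hii]
    exact Nat.eq_of_mul_eq_mul_left hk0 (Nat.pow_right_injective hp.two_le h1)
  have hle : ∀ i, i ≤ g i := fun i => by
    refine (strictMono_nat_of_lt_succ fun i => Nat.lt_of_mul_lt_mul_left (a := v) ?_).le_apply
    have h1 : p ^ (k * i) < p ^ (k * (i + 1)) :=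
      Nat.pow_lt_pow_right hp.one_lt (Nat.mul_lt_mul_of_pos_left i.lt_succ_self hk0)
    rw [← hgi, ← hgi] at h1
    omega
  refine ⟨k, S.natDegree + 1, hk0, Nat.succ_pos _, hv0, (hmod k).2 dvd_rfl,
    fun i => S.coeff (g i), ?_⟩
  have hsum : S = ∑ i ∈ Finset.range (S.natDegree + 1 + 1), C (S.coeff (g i)) * X ^ g i := by
    conv_lhs => rw [S.as_sum_support_C_mul_X_pow]
    rw [← Finset.sum_image (f := fun n => C (S.coeff n) * X ^ n) (fun i _ j _ h => hginj h)]
    refine Finset.sum_subset ?_ ?_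
    · intro n hn
      obtain ⟨a, ha⟩ := hS n hn
      obtain ⟨i, rfl⟩ := (hmod a).1 ⟨n, by omega⟩
      have h1 : g i = n := by
        have := hgi i
        rw [← ha] at this
        exact Nat.eq_of_mul_eq_mul_left hv0 (by omega)
      refine Finset.mem_image.2 ⟨i, Finset.mem_range.2 ?_, h1⟩
      have := hle i
      have := le_natDegree_of_mem_supp n hn
      omega
    · intro n _ hn
      rw [notMem_support_iff.1 hn, C_0, zero_mul]
  conv_lhs => rw [hsum]
  rw [Polynomial.sum_comp, Finset.mul_sum, Finset.mul_sum]
  refine Finset.sum_congr rfl fun i _ => ?_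
  rw [mul_comp, C_comp, X_pow_comp, ← pow_mul, ← hgi i, pow_succ]
  have : (X : F[X]) ^ v = X ^ (v - 1) * X := by rw [← pow_succ, Nat.sub_add_cancel hv0]
  rw [this]
  ring

end PrimeCharacteristic

/-- Let `T` be a monic polynomial of degree `> 2` over a finite field
`F` of characteristic `p`, with `deg T` distinct roots all in `F`. If some non-constant
`f` satisfies `T∘f = θ(X^q − X)f'` with `θ ≠ 0`, then there are positive integers
`k, m, v` with `v ∣ p^k − 1` and elements `γ, ω_0, …, ω_m ∈ F` such that
`T∘(X^v + γ) = X^{v−1} · Σ_{i=0}^{m} ω_i X^{p^{ki}}`. -/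
theorem stmt6 {F : Type*} [Field F] [Fintype F] (p q : ℕ) (hp : p.Prime)
    [CharP F p] (hq : Fintype.card F = q)
    (T : F[X]) (hmonic : T.Monic) (hdeg : 2 < T.natDegree)
    (hsplit : Multiset.card T.roots = T.natDegree) (hsep : T.roots.Nodup)
    (f : F[X]) (hf : 0 < f.natDegree) (θ : F) (hθ : θ ≠ 0)
    (heq : T.comp f = C θ * ((X ^ q - X) * f.derivative)) :
    ∃ k m v : ℕ, 0 < k ∧ 0 < m ∧ 0 < v ∧ v ∣ p ^ k - 1 ∧
      ∃ (γ : F) (ω : ℕ → F),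
        T.comp (X ^ v + C γ) =
          X ^ (v - 1) * ∑ i ∈ Finset.range (m + 1), C (ω i) * X ^ p ^ (k * i) := by
  have : Fact p.Prime := ⟨hp⟩
  obtain ⟨s, -, hs⟩ := FiniteField.card F p
  rw [hq] at hs
  subst hs
  have hT0 : T.comp f ≠ 0 := comp_ne_zero_of_natDegree_pos hf hmonic.ne_zero
  have hu : derivative (X ^ p ^ (s : ℕ) - X : F[X]) = -1 := by
    rw [derivative_sub, derivative_pow_char_pow X s.ne_zero, derivative_X, zero_sub]
  have hf' : derivative f ≠ 0 := by
    intro h0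
    rw [h0, mul_zero, mul_zero] at heq
    exact hT0 heq
  obtain ⟨_, _, L, N, B, G, P⟩ := exists_presentation (p := p) hθ hu hdeg hsplit hsep hT0 heq
  obtain ⟨γ, v, S, hv, hTS, hS⟩ := P.exists_good hθ hdeg.le hf' heq ((s : ℕ) - 1) one_ne_zero
    (Nat.add_sub_cancel' s.pos)
  obtain ⟨k, m, hk, hm, hv0, hvk, ω, hω⟩ := exists_eq_sum_of_good hv hS
  refine ⟨k, m, v, hk, hm, hv0, hvk, γ, ω, ?_⟩
  rw [← hω]
  have h1 := congrArg (fun g => g.comp (X ^ v)) hTS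
  simpa [comp_assoc] using h1
end

section
/- Let K be a finite field with q^n elements. Then the set {f ∈ K[X] : f^q − f = (X^{q^n} − X)·f′} has exactly q^{2^n} elements; equivalently, it is an F_q-vector space of dimension 2^n. -/
open Polynomial

theorem IsGalois.normalBasis_repr_apply {F L : Type*} [Field F] [Field L] [Algebra F L]
    [FiniteDimensional F L] [IsGalois F L] (h k : Gal(L/F)) (x : L) :
    (IsGalois.normalBasis F L).repr (h x) k = (IsGalois.normalBasis F L).repr x (h⁻¹ * k) := by
  set B := IsGalois.normalBasis F L with hB
  have key : h x = ∑ g, B.repr x (h⁻¹ * g) • B g := by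
    conv_lhs => rw [← B.sum_repr x, map_sum]
    refine Fintype.sum_equiv (Equiv.mulLeft h) _ _ fun g => ?_
    simp only [map_smul, Equiv.coe_mulLeft, inv_mul_cancel_left]
    rw [hB, IsGalois.normalBasis_apply (h * g), IsGalois.normalBasis_apply g, AlgEquiv.mul_apply]
  rw [key, B.repr_sum_self]

theorem ncard_equivariant_functions {F L S : Type*} [Field F] [Field L] [Algebra F L]
    [FiniteDimensional F L] [IsGalois F L] [Finite S] (ρ : Gal(L/F) →* Equiv.Perm S) :
    {b : S → L | ∀ g s, b (ρ g s) = g (b s)}.ncard = Nat.card F ^ Nat.card S := by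
  set B := IsGalois.normalBasis F L with hB
  set Ψ : (S → F) → S → L := fun c s => ∑ g, c (ρ g⁻¹ s) • B g with hΨ
  have hrepr (c : S → F) (s : S) (g) : B.repr (Ψ c s) g = c (ρ g⁻¹ s) := by
    rw [hΨ, B.repr_sum_self]
  have hinj : Function.Injective Ψ := fun c d hcd => by
    ext s
    simpa [hcd, hrepr d s 1] using (hrepr c s 1).symm
  have hrange : {b : S → L | ∀ g s, b (ρ g s) = g (b s)} = Set.range Ψ := by
    ext b
    constructor
    · intro hb
      let c : S → F := fun s => B.repr (b s) 1
      refine ⟨c, funext fun s => B.ext_elem fun g => ?_⟩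
      rw [hrepr c s g]
      change B.repr (b (ρ g⁻¹ s)) 1 = _
      rw [hb, IsGalois.normalBasis_repr_apply]
      simp [hB]
    · rintro ⟨c, rfl⟩ h s
      refine B.ext_elem fun g => ?_
      rw [hrepr, IsGalois.normalBasis_repr_apply, ← hB, hrepr]
      simp
  rw [hrange, Set.ncard_range_of_injective hinj, Nat.card_fun]

theorem ncard_frobenius_twisted_functions {q n : ℕ} (hq : IsPrimePow q)
    {K S : Type*} [Field K] [Fintype K] (hK : Fintype.card K = q ^ n) [Finite S]
    (σ : Equiv.Perm S) (hσ : σ ^ n = 1) :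
    {b : S → K | ∀ s, b s = b (σ s) ^ q}.ncard = q ^ Nat.card S := by
  obtain ⟨p, k, hp, hk, rfl⟩ := (isPrimePow_nat_iff q).1 hq
  have := Fact.mk hp
  rw [← pow_mul] at hK
  have := charP_of_card_eq_prime_pow hK
  let : Algebra (ZMod p) K := ZMod.algebra K p
  have hrank : Module.finrank (ZMod p) K = k * n := by
    have := FiniteField.pow_finrank_eq_card p K
    rw [hK] at this
    exact Nat.pow_right_injective hp.two_le this
  obtain ⟨φ⟩ := FiniteField.nonempty_algHom_of_finrank_dvd (F := ZMod p)
    (K := GaloisField p k) (L := K) (by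
      rw [hrank, GaloisField.finrank p hk.ne']; exact dvd_mul_right _ _)
  let : Algebra (GaloisField p k) K := φ.toRingHom.toAlgebra
  let := Fintype.ofFinite (GaloisField p k)
  have hcard : Nat.card (GaloisField p k) = p ^ k := GaloisField.card p k hk.ne'
  have hcard' : Fintype.card (GaloisField p k) = p ^ k := by rw [← hcard, Nat.card_eq_fintype_card]
  have hfin : Module.finrank (GaloisField p k) K = n := by
    have := Module.card_eq_pow_finrank (K := GaloisField p k) (V := K)
    rw [hK, hcard', ← pow_mul] at this
    exact (Nat.eq_of_mul_eq_mul_left hk (Nat.pow_right_injective hp.two_le this)).symm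
  set Φ := FiniteField.frobeniusAlgEquivOfAlgebraic (GaloisField p k) K with hΦ
  have hΦ_apply (x : K) : Φ x = x ^ p ^ k := by
    rw [hΦ, FiniteField.coe_frobeniusAlgEquivOfAlgebraic, hcard']
  have hgen (g : Gal(K/GaloisField p k)) : g ∈ Subgroup.zpowers Φ := by
    obtain ⟨i, hi⟩ :=
      (FiniteField.bijective_frobeniusAlgEquivOfAlgebraic_pow (GaloisField p k) K).2 g
    exact ⟨i.1, by simpa using hi⟩
  have hdvd : orderOf σ⁻¹ ∣ orderOf Φ := by
    rw [hΦ, FiniteField.orderOf_frobeniusAlgEquivOfAlgebraic, hfin, orderOf_inv]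
    exact orderOf_dvd_of_pow_eq_one hσ
  set ρ := monoidHomOfForallMemZpowers hgen hdvd with hρ
  have hρΦ : ρ Φ = σ⁻¹ := monoidHomOfForallMemZpowers_apply_gen hgen hdvd
  rw [← hcard, ← ncard_equivariant_functions ρ]
  congr 1
  ext b
  simp only [Set.mem_ofPred_eq]
  constructor
  · intro hb g
    have hgen' : g ∈ Submonoid.powers Φ := mem_powers_iff_mem_zpowers.2 (hgen g)
    obtain ⟨i, rfl⟩ := hgen'
    induction i with
    | zero => simp
    | succ i ih =>
      intro s
      have hstep (t : S) : b (ρ Φ t) = Φ (b t) := by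
        rw [hρΦ, hb, hΦ_apply, hcard]; simp
      simp only [pow_succ', map_mul, Equiv.Perm.mul_apply, AlgEquiv.mul_apply] at ih ⊢
      rw [hstep, ih]
  · intro hb s
    have := hb Φ (σ s)
    rwa [hρΦ, hΦ_apply, Equiv.Perm.inv_eq_iff_eq.2 rfl, ← hcard] at this

theorem Polynomial.coeff_X_mul_derivative {R : Type*} [CommRing R] (f : R[X]) (k : ℕ) :
    (X * derivative f).coeff k = k * f.coeff k := by
  cases k with
  | zero => simp
  | succ k => rw [coeff_X_mul, coeff_derivative]; push_cast; ring

theorem Polynomial.coeff_X_pow_mul_derivative {R : Type*} [CommRing R] (f : R[X]) (N k : ℕ) :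
    (X ^ N * derivative f).coeff k =
      if N ≤ k then ((k + 1 - N : ℕ) : R) * f.coeff (k + 1 - N) else 0 := by
  rw [coeff_X_pow_mul']
  split_ifs with h
  · rw [coeff_derivative, show k + 1 - N = k - N + 1 by omega]; push_cast; ring
  · rfl

theorem Polynomial.coeff_pow_expChar_pow {R : Type*} [CommRing R] (p k : ℕ) [ExpChar R p]
    (f : R[X]) (i : ℕ) :
    (f ^ p ^ k).coeff i = if p ^ k ∣ i then f.coeff (i / p ^ k) ^ p ^ k else 0 := by
  rw [← map_iterateFrobenius_expand, coeff_map, coeff_expand (expChar_pow_pos R p k),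
    iterateFrobenius_def]
  split_ifs
  · rfl
  · exact zero_pow (expChar_pow_pos R p k).ne'

theorem pow_sub_eq_iff_coeff {K : Type*} [CommRing K] {p k : ℕ} [ExpChar K p] (N : ℕ)
    (f : K[X]) :
    f ^ p ^ k - f = (X ^ N - X) * derivative f ↔
      ∀ i, (if p ^ k ∣ i then f.coeff (i / p ^ k) ^ p ^ k else 0) - f.coeff i =
        (if N ≤ i then ((i + 1 - N : ℕ) : K) * f.coeff (i + 1 - N) else 0) - i * f.coeff i := by
  simp only [Polynomial.ext_iff, sub_mul, coeff_sub, coeff_X_pow_mul_derivative f N,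
    coeff_X_mul_derivative, coeff_pow_expChar_pow]

theorem pow_sub_eq_iff_rotate {K : Type*} [Field K] {p k m : ℕ} [Fact p.Prime] [CharP K p]
    (hk : k ≠ 0) {q : ℕ} (hq : q = p ^ k) (f : K[X]) :
    f ^ q - f = (X ^ q ^ (m + 1) - X) * derivative f ↔
      (∀ i, 2 * q ^ m ≤ i → f.coeff i = 0) ∧ ∀ i < q ^ (m + 1),
        (2 ≤ i % q → f.coeff i = 0) ∧
        (i % q < 2 → f.coeff i = f.coeff (i / q + i % q * q ^ m) ^ q) := by
  have hp : p.Prime := Fact.out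
  have hq2 : 2 ≤ q := hq ▸ hp.two_le.trans (Nat.le_self_pow hk p)
  have hqm : 0 < q ^ m := by positivity
  set M := q ^ m with hM
  have hN : q ^ (m + 1) = q * M := by rw [pow_succ', hM]
  have hdvd : p ∣ q := hq ▸ dvd_pow_self p hk
  have hqK : (q : K) = 0 := (CharP.cast_eq_zero_iff K p q).2 hdvd
  have hcast (i : ℕ) : ((i % q : ℕ) : K) = i := by
    conv_rhs => rw [← Nat.div_add_mod i q]
    simp [hqK]
  rw [hN]
  have hNpos : 0 < q * M := by positivity
  conv_lhs => rw [hq, pow_sub_eq_iff_coeff, ← hq]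
  have hle : 2 * M ≤ q * M := Nat.mul_le_mul_right M hq2
  constructor
  · intro h
    have hdeg : f.natDegree < 2 * M := by
      by_contra! hd
      have h1 : (q - 1) * (2 * M) ≤ (q - 1) * f.natDegree := Nat.mul_le_mul_left _ hd
      have h2 : (q - 1) * (2 * M) = 2 * (q * M) - 2 * M := by
        rw [Nat.sub_mul]; congr 1 <;> ring
      have h3 : (q - 1) * f.natDegree = q * f.natDegree - f.natDegree := by
        rw [Nat.sub_mul, one_mul]
      have h4 : f.natDegree * 2 ≤ q * f.natDegree := by rw [mul_comm]; gcongr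
      have := h (q * f.natDegree)
      rw [if_pos (dvd_mul_right _ _), Nat.mul_div_cancel_left _ (by omega),
        coeff_eq_zero_of_natDegree_lt (n := q * f.natDegree) (by omega),
        coeff_eq_zero_of_natDegree_lt (n := q * f.natDegree + 1 - q * M) (by omega)] at this
      simp only [mul_zero, ite_self, sub_zero] at this
      have hf : f = 0 := by simpa using eq_zero_of_pow_eq_zero this
      rw [hf] at hd
      simp at hd
      omega
    have hbd (i : ℕ) (hi : 2 * M ≤ i) : f.coeff i = 0 :=
      coeff_eq_zero_of_natDegree_lt (by omega)
    refine ⟨hbd, fun i hi => ?_⟩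
    have hlow := h i
    rw [if_neg (show ¬ q * M ≤ i by omega)] at hlow
    have hhigh (hi0 : 0 < i) : (if q ∣ q * M + i - 1 then
        f.coeff ((q * M + i - 1) / q) ^ q else 0) = i * f.coeff i := by
      have := h (q * M + i - 1)
      rw [hbd (q * M + i - 1) (by omega), if_pos (show q * M ≤ q * M + i - 1 by omega),
        show q * M + i - 1 + 1 - q * M = i by omega] at this
      simpa using this
    have hi_eq := Nat.div_add_mod i q
    refine ⟨fun h2 => ?_, fun h2 => ?_⟩
    · have hndvd : ¬ q ∣ i := fun hd => by rw [Nat.dvd_iff_mod_eq_zero.1 hd] at h2; omega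
      by_cases hi1 : (i : K) = 1
      · have hi0 : 0 < i := Nat.pos_of_ne_zero (by rintro rfl; simp at h2)
        have := hhigh hi0
        rw [if_neg, hi1, one_mul] at this
        · exact this.symm
        · rw [show q * M + i - 1 = (i % q - 1) + q * (M + i / q) by
            rw [mul_add]; omega, Nat.dvd_add_left (dvd_mul_right _ _)]
          intro hd
          have := Nat.le_of_dvd (by omega) hd
          have := Nat.mod_lt i (by omega : 0 < q)
          omega
      · rw [if_neg hndvd] at hlow
        have : ((i : K) - 1) * f.coeff i = 0 := by linear_combination hlow
        exact (mul_eq_zero.1 this).resolve_left (sub_ne_zero.2 hi1)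
    · have hiK := hcast i
      interval_cases hr : i % q
      · rw [if_pos (Nat.dvd_of_mod_eq_zero hr), ← hiK] at hlow
        rw [zero_mul, add_zero]
        linear_combination -hlow
      · have := hhigh (by by_contra! h0; simp [Nat.le_zero.1 h0] at hr)
        rw [← hiK, show q * M + i - 1 = q * (i / q + 1 * M) by rw [mul_add, one_mul]; omega,
          if_pos (dvd_mul_right _ _), Nat.mul_div_cancel_left _ (by omega)] at this
        rw [this]; simp
  · rintro ⟨hbd, h⟩ i
    have hi_eq := Nat.div_add_mod i q
    have hmod := Nat.mod_lt i (by omega : 0 < q)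
    by_cases hi : q * M ≤ i
    · rw [if_pos hi, hbd i (by omega)]
      obtain ⟨j, hj⟩ : ∃ j, j = i + 1 - q * M := ⟨_, rfl⟩
      rw [← hj, mul_zero, sub_zero, sub_zero]
      by_cases hjN : q * M ≤ j
      · rw [hbd j (by omega), mul_zero]
        refine ite_eq_right_iff.2 fun hd => ?_
        rw [hbd, zero_pow (by omega)]
        obtain ⟨t, rfl⟩ := hd
        rw [Nat.mul_div_cancel_left _ (by omega)]
        by_contra! ht
        have h5 : q * (t + 1) ≤ q * (2 * M) := Nat.mul_le_mul_left q ht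
        have h6 : q * (2 * M) = 2 * (q * M) := by ring
        rw [mul_add, mul_one] at h5
        omega
      · obtain ⟨h2, h1⟩ := h j (by omega)
        have hj_eq := Nat.div_add_mod j q
        have hjmod := Nat.mod_lt j (by omega : 0 < q)
        have hjK := hcast j
        by_cases hr2 : 2 ≤ j % q
        · rw [h2 hr2, if_neg, mul_zero]
          rw [show i = (j % q - 1) + q * (M + j / q) by rw [mul_add]; omega,
            Nat.dvd_add_left (dvd_mul_right _ _)]
          intro hd
          have := Nat.le_of_dvd (by omega) hd
          omega
        · obtain hr | hr : j % q = 0 ∨ j % q = 1 := by omega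
          · rw [← hjK, hr, if_neg]
            · simp
            · intro hd
              have h7 : q ∣ i + 1 := ⟨M + j / q, by rw [mul_add]; omega⟩
              have := Nat.le_of_dvd one_pos ((Nat.dvd_add_right hd).1 h7)
              omega
          · specialize h1 (by omega)
            rw [hr] at h1
            rw [← hjK, hr, show i = q * (j / q + 1 * M) by rw [mul_add, one_mul]; omega,
              if_pos (dvd_mul_right _ _), Nat.mul_div_cancel_left _ (by omega), ← h1]
            simp
    · obtain ⟨h2, h1⟩ := h i (by omega)
      have hiK := hcast i
      rw [if_neg hi]
      by_cases hr2 : 2 ≤ i % q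
      · rw [h2 hr2, if_neg]; simp
        intro hd; rw [Nat.dvd_iff_mod_eq_zero.1 hd] at hr2; omega
      · specialize h1 (by omega)
        obtain hr | hr : i % q = 0 ∨ i % q = 1 := by omega
        · rw [hr] at hiK h1
          rw [zero_mul, add_zero] at h1
          rw [if_pos (Nat.dvd_of_mod_eq_zero hr), ← hiK, ← h1]; simp
        · rw [hr] at hiK
          rw [if_neg, ← hiK]; simp
          intro hd; rw [Nat.dvd_iff_mod_eq_zero.1 hd] at hr; omega

/-- The number whose base-`q` digits, from the least significant one on, are the values of `v`. -/
def digitValue (q : ℕ) {n : ℕ} (v : Fin n → ℕ) : ℕ := ∑ i, v i * q ^ (i : ℕ)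

theorem digitValue_eq_finFunctionFinEquiv {q n : ℕ} {v : Fin n → ℕ} (hv : ∀ i, v i < q) :
    digitValue q v = (finFunctionFinEquiv fun i => (⟨v i, hv i⟩ : Fin q) : ℕ) := by
  rw [finFunctionFinEquiv_apply, digitValue]

theorem digitValue_lt {q n : ℕ} {v : Fin n → ℕ} (hv : ∀ i, v i < q) :
    digitValue q v < q ^ n := by
  rw [digitValue_eq_finFunctionFinEquiv hv]
  exact Fin.is_lt _

theorem digitValue_inj {q n : ℕ} {v w : Fin n → ℕ} (hv : ∀ i, v i < q) (hw : ∀ i, w i < q)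
    (h : digitValue q v = digitValue q w) : v = w := by
  rw [digitValue_eq_finFunctionFinEquiv hv, digitValue_eq_finFunctionFinEquiv hw] at h
  have := finFunctionFinEquiv.injective (Fin.ext h)
  funext i
  exact Fin.mk.inj_iff.1 (congrFun this i)

theorem exists_digitValue_eq {q n i : ℕ} (hi : i < q ^ n) :
    ∃ v : Fin n → ℕ, (∀ j, v j < q) ∧ digitValue q v = i := by
  refine ⟨fun j => (finFunctionFinEquiv.symm ⟨i, hi⟩ j : Fin q), fun j => Fin.is_lt _, ?_⟩
  rw [digitValue_eq_finFunctionFinEquiv fun j => Fin.is_lt _]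
  exact congrArg Fin.val (finFunctionFinEquiv.apply_symm_apply ⟨i, hi⟩)

theorem digitValue_succ (q : ℕ) {m : ℕ} (v : Fin (m + 1) → ℕ) :
    digitValue q v = v 0 + q * digitValue q (fun i : Fin m => v i.succ) := by
  simp only [digitValue, Fin.sum_univ_succ, Finset.mul_sum, Fin.val_zero, pow_zero, mul_one,
    Fin.val_succ, pow_succ']
  congr 1
  exact Finset.sum_congr rfl fun i _ => by ring

theorem digitValue_castSucc (q : ℕ) {m : ℕ} (v : Fin (m + 1) → ℕ) :
    digitValue q v = digitValue q (fun i : Fin m => v i.castSucc) + v (Fin.last m) * q ^ m := by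
  simp [digitValue, Fin.sum_univ_castSucc]

theorem digitValue_mod {q m : ℕ} {v : Fin (m + 1) → ℕ} (hv : v 0 < q) :
    digitValue q v % q = v 0 := by
  rw [digitValue_succ, Nat.add_mul_mod_self_left, Nat.mod_eq_of_lt hv]

theorem digitValue_comp_finRotate {q m : ℕ} {v : Fin (m + 1) → ℕ} (hv : v 0 < q) :
    digitValue q (v ∘ finRotate (m + 1)) =
      digitValue q v / q + digitValue q v % q * q ^ m := by
  rw [digitValue_mod hv, digitValue_castSucc]
  congr 1
  · rw [digitValue_succ q v, Nat.add_mul_div_left _ _ (by omega), Nat.div_eq_of_lt hv, zero_add]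
    simp [Fin.succ]
  · simp

theorem finRotate_pow_self (n : ℕ) : finRotate n ^ n = 1 := by
  cases n with
  | zero => simp
  | succ m =>
    have key (k : ℕ) (i : Fin (m + 1)) : (finRotate (m + 1) ^ k) i = i + k • 1 := by
      induction k with
      | zero => simp
      | succ k ih => rw [pow_succ', Equiv.Perm.mul_apply, ih, finRotate_apply, succ_nsmul,
        add_assoc]
    have hone : (m + 1) • (1 : Fin (m + 1)) = 0 := by
      simpa using card_nsmul_eq_zero' (x := (1 : Fin (m + 1)))
    ext i
    rw [key, hone, add_zero, Equiv.Perm.one_apply]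

theorem pow_sub_eq_iff_digitValue {K : Type*} [Field K] {p k m : ℕ} [Fact p.Prime] [CharP K p]
    (hk : k ≠ 0) {q : ℕ} (hq : q = p ^ k) (f : K[X]) :
    f ^ q - f = (X ^ q ^ (m + 1) - X) * derivative f ↔
      (∀ i, f.coeff i ≠ 0 → ∃ s : Fin (m + 1) → Fin 2, i = digitValue q fun j => (s j : ℕ)) ∧
      ∀ s : Fin (m + 1) → Fin 2, f.coeff (digitValue q fun j => (s j : ℕ)) =
        f.coeff (digitValue q fun j => (s (finRotate (m + 1) j) : ℕ)) ^ q := by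
  have hp : p.Prime := Fact.out
  have hq2 : 2 ≤ q := hq ▸ hp.two_le.trans (Nat.le_self_pow hk p)
  have hsq (s : Fin (m + 1) → Fin 2) (j) : (s j : ℕ) < q := (s j).is_lt.trans_le hq2
  have hle : 2 * q ^ m ≤ q ^ (m + 1) := by rw [pow_succ']; gcongr
  rw [pow_sub_eq_iff_rotate hk hq]
  constructor
  · rintro ⟨hbd, h⟩
    refine ⟨fun i hi => ?_, fun s => ?_⟩
    · obtain ⟨v, hv, rfl⟩ := exists_digitValue_eq (q := q) (n := m + 1) (i := i) (by
        by_contra! hlt; exact hi (hbd i (hle.trans hlt)))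
      have key (j : Fin (m + 1)) : ∀ v : Fin (m + 1) → ℕ, (∀ j, v j < q) →
          f.coeff (digitValue q v) ≠ 0 → v j < 2 := by
        induction j using Fin.induction with
        | zero =>
          intro v hv hi
          by_contra! h2
          exact hi ((h _ (digitValue_lt hv)).1 (by rwa [digitValue_mod (hv 0)]))
        | succ j ih =>
          intro v hv hi
          have h0 : digitValue q v % q < 2 := by
            by_contra! h2
            exact hi ((h _ (digitValue_lt hv)).1 h2)
          have := ih (v ∘ finRotate (m + 1)) (fun j => hv _) fun h1 => hi (by
            rw [(h _ (digitValue_lt hv)).2 h0, ← digitValue_comp_finRotate (hv 0), h1,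
              zero_pow (by omega)])
          simpa using this
      exact ⟨fun j => ⟨v j, key j v hv hi⟩, rfl⟩
    · rw [(h _ (digitValue_lt (hsq s))).2 (by rw [digitValue_mod (hsq s 0)]; exact (s 0).is_lt),
        ← digitValue_comp_finRotate (hsq s 0)]
      rfl
  · rintro ⟨hsupp, hrot⟩
    refine ⟨fun i hi => ?_, fun i hi => ⟨fun h2 => ?_, fun h2 => ?_⟩⟩
    · by_contra h0
      obtain ⟨s, rfl⟩ := hsupp i h0
      rw [digitValue_castSucc] at hi
      have h1 := digitValue_lt (q := q) (v := fun i : Fin m => (s i.castSucc : ℕ)) fun _ => hsq s _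
      have h2 : (s (Fin.last m) : ℕ) * q ^ m ≤ 1 * q ^ m := by gcongr; omega
      omega
    · by_contra h0
      obtain ⟨s, rfl⟩ := hsupp i h0
      rw [digitValue_mod (hsq s 0)] at h2
      omega
    · obtain ⟨v, hv, rfl⟩ := exists_digitValue_eq hi
      rw [← digitValue_comp_finRotate (hv 0)]
      by_cases hs : ∀ j, v j < 2
      · exact hrot fun j => ⟨v j, hs j⟩
      · have hzero (w : Fin (m + 1) → ℕ) (hw : ∀ j, w j < q) (hw2 : ¬ ∀ j, w j < 2) :
            f.coeff (digitValue q w) = 0 := by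
          by_contra h0
          obtain ⟨s, hs⟩ := hsupp _ h0
          refine hw2 fun j => ?_
          rw [digitValue_inj hw (hsq s) hs]
          exact (s j).is_lt
        rw [hzero v hv hs, hzero (v ∘ finRotate (m + 1)) (fun j => hv _), zero_pow (by omega)]
        exact fun h => hs fun j => by simpa using h ((finRotate (m + 1)).symm j)

/-- Let `K` have `q^n` elements. The set
`W(X^q − X | K) = {f ∈ K[X] : f^q − f = (X^{q^n} − X)·f'}` has exactly `q^{2^n}`
elements (equivalently, it is an `F_q`-vector space of dimension `2^n`). -/
theorem stmt13 (q n : ℕ) (hq : IsPrimePow q) (hn : 1 ≤ n)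
    {K : Type*} [Field K] [Fintype K] (hK : Fintype.card K = q ^ n) :
    {f : K[X] | f ^ q - f = (X ^ q ^ n - X) * f.derivative}.ncard = q ^ 2 ^ n := by
  obtain ⟨m, rfl⟩ : ∃ m, n = m + 1 := ⟨n - 1, by omega⟩
  obtain ⟨p, k, hp, hk, hqp⟩ := (isPrimePow_nat_iff q).1 hq
  have := Fact.mk hp
  have : CharP K p := by
    rw [← hqp, ← pow_mul] at hK
    exact charP_of_card_eq_prime_pow hK
  set σ : Equiv.Perm (Fin (m + 1) → Fin 2) :=
    (finRotate (m + 1)).symm.arrowCongr (Equiv.refl _) with hσ_def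
  have hσ : σ ^ (m + 1) = 1 := by
    have key (j : ℕ) (s : Fin (m + 1) → Fin 2) : (σ ^ j) s = s ∘ (finRotate (m + 1) ^ j) := by
      induction j with
      | zero => rfl
      | succ j ih => rw [pow_succ', Equiv.Perm.mul_apply, ih, pow_succ]; rfl
    ext s : 1
    rw [key, finRotate_pow_self]
    rfl
  have hcount := ncard_frobenius_twisted_functions hq hK σ hσ
  rw [Nat.card_fun, Nat.card_fin, Nat.card_fin] at hcount
  set e : (Fin (m + 1) → Fin 2) → ℕ := fun s => digitValue q fun j => (s j : ℕ) with he
  have hsq (s : Fin (m + 1) → Fin 2) (j) : (s j : ℕ) < q := (s j).is_lt.trans_le hq.two_le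
  have he_inj : Function.Injective e := fun s t h =>
    funext fun j => Fin.ext (congrFun (digitValue_inj (hsq s) (hsq t) h) j)
  rw [← hcount]
  symm
  refine Set.ncard_congr (fun b _ => ∑ s, monomial (e s) (b s)) ?_ ?_ ?_
  all_goals
    have hcoeff (b : (Fin (m + 1) → Fin 2) → K) (t) :
        (∑ s, monomial (e s) (b s)).coeff (e t) = b t := by
      simp [coeff_monomial, he_inj.eq_iff]
  · intro b hb
    refine (pow_sub_eq_iff_digitValue hk.ne' hqp.symm _).2 ⟨fun i hi => ?_, fun s => ?_⟩
    · rw [finsetSum_coeff] at hi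
      obtain ⟨s, -, hs⟩ := Finset.exists_ne_zero_of_sum_ne_zero hi
      rw [coeff_monomial] at hs
      exact ⟨s, (ite_ne_right_iff.1 hs).1.symm⟩
    · have := hb s
      rwa [← hcoeff b s, ← hcoeff b (σ s)] at this
  · intro b c _ _ h
    funext s
    rw [← hcoeff b s, h, hcoeff c s]
  · intro f hf
    obtain ⟨hsupp, hrot⟩ := (pow_sub_eq_iff_digitValue hk.ne' hqp.symm f).1 hf
    refine ⟨fun s => f.coeff (e s), hrot, ?_⟩
    ext i
    by_cases hi : ∃ s, i = e s
    · obtain ⟨s, rfl⟩ := hi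
      exact hcoeff _ s
    · rw [finsetSum_coeff, Finset.sum_eq_zero fun s _ => by
        rw [coeff_monomial, if_neg fun h => hi ⟨s, h.symm⟩]]
      by_contra h0
      exact hi (hsupp i (Ne.symm h0))
end
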